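/- arXiv:2605.22006 — 2 statements merged into one kernel-verified Lean document; each statement's English description precedes it below -/
import Mathlib

section
/- Let ν > 0, T > 0, α ∈ (0,1), and let f : [0,T] × ℝ^d → ℝ be continuous and bounded, smooth in the space variable with every spatial derivative bounded on [0,T] × ℝ^d, and with M := sup_{0 ≤ t ≤ T} [f(t,·)]_{C^α} < ∞. Define u(t,x) = ∫_0^t ∫_{ℝ^d} G_{ν(t−τ)}(y) f(τ, x−y) dy dτ. Then there exists a constant C depending only on α and d — in particular independent of ν, T and f — such that for every t ∈ (0,T] and all x, h ∈ ℝ^d: ν |Δ_x u(t, x+h) − Δ_x u(t, x)| ≤ C M |h|^α, where Δ_x is the Laplacian in the space variable. -/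
open MeasureTheory Set
open scoped ENNReal

noncomputable def heatKernel (d : ℕ) (s : ℝ) (y : (EuclideanSpace ℝ (Fin d))) : ℝ :=
  (4 * Real.pi * s) ^ (-(d : ℝ) / 2) * Real.exp (-(‖y‖ ^ 2) / (4 * s))
noncomputable def lap (d : ℕ) (f : (EuclideanSpace ℝ (Fin d)) → ℝ) (x : (EuclideanSpace ℝ (Fin d))) : ℝ :=
  ∑ j, fderiv ℝ (fun y => fderiv ℝ f y (EuclideanSpace.single j 1)) x
    (EuclideanSpace.single j 1)

lemma norm_rpow_le_exp {E : Type*} [NormedAddCommGroup E] {α b : ℝ} (hα : 0 ≤ α) (hα2 : α ≤ 2)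
    (hb : 0 < b) (z : E) : ‖z‖ ^ α ≤ (1 + 1 / b) * Real.exp (b * ‖z‖ ^ 2) := by
  have h1 : ‖z‖ ^ α ≤ 1 + ‖z‖ ^ 2 := by
    rcases le_total ‖z‖ 1 with h | h
    · have := Real.rpow_le_one (norm_nonneg z) h hα
      nlinarith [sq_nonneg ‖z‖]
    · have := Real.rpow_le_rpow_of_exponent_le h hα2
      rw [Real.rpow_two] at this
      linarith
  have h2 := Real.add_one_le_exp (b * ‖z‖ ^ 2)
  have h3 : 0 ≤ b * ‖z‖ ^ 2 := by positivity
  have h4 : ‖z‖ ^ 2 = 1 / b * (b * ‖z‖ ^ 2) := by field_simp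
  have h5 : 0 < 1 / b := by positivity
  calc ‖z‖ ^ α ≤ 1 + ‖z‖ ^ 2 := h1
    _ = 1 + 1 / b * (b * ‖z‖ ^ 2) := by rw [← h4]
    _ ≤ _ := by nlinarith

lemma integrable_exp_neg_mul_norm_sq (d : ℕ) {b : ℝ} (hb : 0 < b) :
    Integrable (fun z : EuclideanSpace ℝ (Fin d) => Real.exp (-b * ‖z‖ ^ 2)) := by
  have h := (GaussianFourier.integrable_cexp_neg_mul_sq_norm_add
    (V := EuclideanSpace ℝ (Fin d)) (b := (b : ℂ)) (by simpa using hb) 0 0).norm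
  refine h.congr (Filter.Eventually.of_forall fun z => ?_)
  simp only [Complex.norm_exp]
  congr 1
  simp [← Complex.ofReal_pow]

lemma integrable_norm_rpow_mul_exp (d : ℕ) {α b : ℝ} (hα : 0 ≤ α) (hα2 : α ≤ 2) (hb : 0 < b) :
    Integrable (fun z : EuclideanSpace ℝ (Fin d) => ‖z‖ ^ α * Real.exp (-b * ‖z‖ ^ 2)) := by
  refine ((integrable_exp_neg_mul_norm_sq d (half_pos hb)).const_mul (1 + 1 / (b / 2))).mono'
    ?_ (Filter.Eventually.of_forall fun z => ?_)
  · exact ((Real.continuous_rpow_const hα).comp continuous_norm).mul (by fun_prop)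
      |>.aestronglyMeasurable
  · rw [Real.norm_of_nonneg (by positivity)]
    calc ‖z‖ ^ α * Real.exp (-b * ‖z‖ ^ 2)
        ≤ ((1 + 1 / (b / 2)) * Real.exp (b / 2 * ‖z‖ ^ 2)) * Real.exp (-b * ‖z‖ ^ 2) := by
          gcongr
          exact norm_rpow_le_exp hα hα2 (half_pos hb) z
      _ = _ := by
          rw [mul_assoc, ← Real.exp_add]
          congr 2
          ring

lemma hasFDerivAt_heatKernel_one (d : ℕ) (z : EuclideanSpace ℝ (Fin d)) :
    HasFDerivAt (heatKernel d 1) ((-(1 / 2) * heatKernel d 1 z) • innerSL ℝ z) z := by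
  unfold heatKernel
  have h := ((((hasStrictFDerivAt_norm_sq z).hasFDerivAt.neg).mul_const ((4 * 1 : ℝ)⁻¹)).exp).const_mul
    ((4 * Real.pi * 1) ^ (-(d : ℝ) / 2))
  convert! h using 1
  ext v
  simp
  ring_nf

lemma heatKernel_one_nonneg (d : ℕ) (z : EuclideanSpace ℝ (Fin d)) : 0 ≤ heatKernel d 1 z := by
  unfold heatKernel
  positivity

lemma exists_heatKernel_one_le (d n : ℕ) : ∃ K, 0 < K ∧ ∀ z : EuclideanSpace ℝ (Fin d),
    (1 + ‖z‖ ^ n) * heatKernel d 1 z ≤ K * Real.exp (-(1 / 8) * ‖z‖ ^ 2) := by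
  have hc : 0 < (4 * Real.pi * 1) ^ (-(d : ℝ) / 2) := by positivity
  refine ⟨(2 + 8 ^ n * n.factorial) * (4 * Real.pi * 1) ^ (-(d : ℝ) / 2), by positivity,
    fun z => ?_⟩
  have h1 : (‖z‖ ^ 2 / 8) ^ n ≤ n.factorial * Real.exp (‖z‖ ^ 2 / 8) := by
    have := Real.pow_div_factorial_le_exp (‖z‖ ^ 2 / 8) (by positivity) n
    rwa [div_le_iff₀' (by positivity)] at this
  have h2 : ‖z‖ ^ n ≤ 1 + 8 ^ n * (‖z‖ ^ 2 / 8) ^ n := by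
    have : 8 ^ n * (‖z‖ ^ 2 / 8) ^ n = (‖z‖ ^ n) ^ 2 := by
      rw [← mul_pow, mul_div_cancel₀ _ (by norm_num), ← pow_mul, ← pow_mul, mul_comm]
    rw [this]
    nlinarith [sq_nonneg (‖z‖ ^ n - 1)]
  have h3 : 1 ≤ Real.exp (‖z‖ ^ 2 / 8) := Real.one_le_exp (by positivity)
  have h4 : 1 + ‖z‖ ^ n ≤ (2 + 8 ^ n * n.factorial) * Real.exp (‖z‖ ^ 2 / 8) := by
    calc 1 + ‖z‖ ^ n ≤ 1 + (1 + 8 ^ n * (n.factorial * Real.exp (‖z‖ ^ 2 / 8))) := by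
          gcongr
          exact h2.trans (by gcongr)
      _ ≤ _ := by linarith
  calc (1 + ‖z‖ ^ n) * heatKernel d 1 z
      ≤ ((2 + 8 ^ n * n.factorial) * Real.exp (‖z‖ ^ 2 / 8)) * heatKernel d 1 z := by
        gcongr
        exact heatKernel_one_nonneg d z
    _ = (2 + 8 ^ n * n.factorial) * (4 * Real.pi * 1) ^ (-(d : ℝ) / 2) *
          (Real.exp (‖z‖ ^ 2 / 8) * Real.exp (-(‖z‖ ^ 2) / (4 * 1))) := by
        unfold heatKernel
        ring
    _ = _ := by
        rw [← Real.exp_add]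
        congr 2
        ring

/-- Gaussian bounds for the unit-time heat kernel, its first two derivatives in a unit direction,
and the gradient of the second one. -/
lemma exists_heatKernel_one_deriv (d : ℕ) {e : EuclideanSpace ℝ (Fin d)} (he : ‖e‖ = 1) :
    ∃ (g₁ g₂ : EuclideanSpace ℝ (Fin d) → ℝ) (K : ℝ), 0 < K ∧
      Differentiable ℝ (heatKernel d 1) ∧ Differentiable ℝ g₁ ∧ Differentiable ℝ g₂ ∧
      (∀ z, fderiv ℝ (heatKernel d 1) z e = g₁ z) ∧ (∀ z, fderiv ℝ g₁ z e = g₂ z) ∧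
      (∀ z, |heatKernel d 1 z| ≤ K * Real.exp (-(1 / 8) * ‖z‖ ^ 2)) ∧
      (∀ z, |g₁ z| ≤ K * Real.exp (-(1 / 8) * ‖z‖ ^ 2)) ∧
      (∀ z, |g₂ z| ≤ K * Real.exp (-(1 / 8) * ‖z‖ ^ 2)) ∧
      (∀ z, ‖fderiv ℝ g₂ z‖ ≤ K * Real.exp (-(1 / 8) * ‖z‖ ^ 2)) := by
  obtain ⟨K, hK, hb⟩ := exists_heatKernel_one_le d 3
  have hin : ∀ z, HasFDerivAt (fun z => inner ℝ z e) (innerSL ℝ e) z := by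
    intro z
    convert! (innerSL ℝ e).hasFDerivAt (x := z) using 1
    ext w
    simp [real_inner_comm]
  have hg := hasFDerivAt_heatKernel_one d
  have h1 := fun z => ((hin z).const_mul (-(1 / 2))).mul (hg z)
  have h2 := fun z => ((((hin z).pow 2).mul_const (1 / 4)).sub_const (1 / 2)).mul (hg z)
  have hz : ∀ z, |inner ℝ z e| ≤ ‖z‖ := fun z => by
    simpa [he] using abs_real_inner_le_norm z e
  refine ⟨_, _, K, hK, fun z => (hg z).differentiableAt, fun z => (h1 z).differentiableAt,
    fun z => (h2 z).differentiableAt, fun z => ?_, fun z => ?_, fun z => ?_, fun z => ?_,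
    fun z => ?_, fun z => ?_⟩
  · rw [(hg z).fderiv]
    simp
    ring
  · erw [(h1 z).fderiv]
    simp [he]
    ring
  all_goals
    have hg0 := heatKernel_one_nonneg d z
    have hn := norm_nonneg z
    have hz' := hz z
    refine le_trans ?_ (hb z)
  · rw [abs_of_nonneg hg0]
    have : 0 ≤ ‖z‖ ^ 3 := by positivity
    nlinarith
  · simp only [Pi.mul_apply]
    rw [abs_mul, abs_of_nonneg hg0, abs_mul]
    gcongr
    norm_num
    nlinarith [sq_nonneg (‖z‖ - 1), sq_nonneg ‖z‖, mul_nonneg hn (sq_nonneg (‖z‖ - 1))]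
  · simp only [Pi.mul_apply]
    rw [abs_mul, abs_of_nonneg hg0]
    gcongr
    have : inner ℝ z e ^ 2 ≤ ‖z‖ ^ 2 := sq_le_sq.mpr (by simpa using hz')
    rw [abs_le]
    constructor <;>
    nlinarith [sq_nonneg (‖z‖ - 1), sq_nonneg ‖z‖, mul_nonneg hn (sq_nonneg (‖z‖ - 1)), sq_nonneg (inner ℝ z e : ℝ), pow_nonneg hn 3]
  · erw [(h2 z).fderiv]
    have hsq : inner ℝ z e ^ 2 ≤ ‖z‖ ^ 2 := sq_le_sq.mpr (by simpa using hz')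
    have hp : |inner ℝ z e ^ 2 * (1 / 4) - 1 / 2| ≤ ‖z‖ ^ 2 / 4 + 1 / 2 := by
      rw [abs_le]
      constructor <;> nlinarith [sq_nonneg (inner ℝ z e : ℝ)]
    refine (norm_add_le _ _).trans ?_
    simp only [norm_smul, Real.norm_eq_abs, innerSL_apply_norm, he, abs_mul, abs_of_nonneg hg0]
    norm_num
    norm_num at hp
    have h3 : (1 / 4 * (2 * |inner ℝ z e|)) ≤ ‖z‖ / 2 := by linarith
    calc _ ≤ (‖z‖ ^ 2 / 4 + 1 / 2) * (1 / 2 * heatKernel d 1 z * ‖z‖) +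
          heatKernel d 1 z * (‖z‖ / 2) := by
            gcongr
      _ = (‖z‖ ^ 3 / 8 + 3 / 4 * ‖z‖) * heatKernel d 1 z := by ring
      _ ≤ _ := by
        refine mul_le_mul_of_nonneg_right ?_ hg0
        nlinarith [sq_nonneg (‖z‖ - 1), mul_nonneg hn (sq_nonneg (‖z‖ - 1)), pow_nonneg hn 3]

open Filter in
lemma integral_mul_fderiv_comp (d : ℕ) {k ψ : EuclideanSpace ℝ (Fin d) → ℝ} {B r : ℝ} (hr : 0 < r)
    (e : EuclideanSpace ℝ (Fin d))
    (hk : Differentiable ℝ k) (hki : Integrable k) (hki' : Integrable (fun z => fderiv ℝ k z e))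
    (hψ : ContDiff ℝ 1 ψ) (hB : ∀ y, |ψ y| ≤ B) (hB' : ∀ y, |fderiv ℝ ψ y e| ≤ B)
    (x : EuclideanSpace ℝ (Fin d)) :
    ∫ z, k z * fderiv ℝ ψ (x - r • z) e = r⁻¹ * ∫ z, fderiv ℝ k z e * ψ (x - r • z) := by
  have hd : ∀ z, HasFDerivAt (fun z => ψ (x - r • z))
      ((fderiv ℝ ψ (x - r • z)).comp (-(r • ContinuousLinearMap.id ℝ _))) z := fun z =>
    ((hψ.differentiable (by simp)) _).hasFDerivAt.comp z
      (((hasFDerivAt_id z).const_smul r).const_sub x)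
  have hd' : ∀ z, fderiv ℝ (fun z => ψ (x - r • z)) z e = -(r * fderiv ℝ ψ (x - r • z) e) := by
    intro z
    rw [(hd z).fderiv]
    simp
  have hc : Continuous (fun y => fderiv ℝ ψ y e) :=
    (hψ.continuous_fderiv (by simp)).clm_apply continuous_const
  have hc0 := hψ.continuous
  have h1 : Integrable (fun z => k z * fderiv ℝ ψ (x - r • z) e) :=
    hki.mul_bdd (c := B) (by fun_prop) (Eventually.of_forall fun z => hB' _)
  have h := integral_mul_fderiv_eq_neg_fderiv_mul_of_integrable (μ := volume) (f := k)
    (g := fun z => ψ (x - r • z)) (v := e)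
    (hki'.mul_bdd (c := B) (by fun_prop) (Eventually.of_forall fun z => hB _))
    (by
      simp only [hd']
      refine (h1.const_mul (-r)).congr (Eventually.of_forall fun z => ?_)
      simp only []; ring)
    (hki.mul_bdd (c := B) (by fun_prop) (Eventually.of_forall fun z => hB _))
    (fun z _ => hk z) (fun z _ => (hd z).differentiableAt)
  simp only [hd'] at h
  have h2 : ∫ z, k z * -(r * fderiv ℝ ψ (x - r • z) e)
      = -r * ∫ z, k z * fderiv ℝ ψ (x - r • z) e := by
    rw [← integral_const_mul]
    congr 1 with z
    ring
  rw [h2] at h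
  field_simp
  linarith

lemma Differentiable.integrable_of_le_gaussian {d : ℕ} {k : EuclideanSpace ℝ (Fin d) → ℝ} {K : ℝ}
    (hk : Differentiable ℝ k) (hb : ∀ z, |k z| ≤ K * Real.exp (-(1 / 8) * ‖z‖ ^ 2)) :
    Integrable k :=
  ((integrable_exp_neg_mul_norm_sq d (by norm_num : (0 : ℝ) < 1 / 8)).const_mul K).mono'
    hk.continuous.aestronglyMeasurable (Filter.Eventually.of_forall hb)

lemma abs_sub_le_gaussian {d : ℕ} {k : EuclideanSpace ℝ (Fin d) → ℝ} {K : ℝ} (hK : 0 < K)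
    (hk : Differentiable ℝ k)
    (hb : ∀ z, ‖fderiv ℝ k z‖ ≤ K * Real.exp (-(1 / 8) * ‖z‖ ^ 2))
    (z w : EuclideanSpace ℝ (Fin d)) (hw : ‖w‖ ≤ 1) :
    |k (z + w) - k z| ≤ K * Real.exp (1 / 8) * Real.exp (-(1 / 16) * ‖z‖ ^ 2) * ‖w‖ := by
  have h := (convex_closedBall z ‖w‖).norm_image_sub_le_of_norm_fderiv_le
    (f := k) (C := K * Real.exp (1 / 8) * Real.exp (-(1 / 16) * ‖z‖ ^ 2))
    (fun x _ => hk x) (fun x hx => ?_) (Metric.mem_closedBall_self (norm_nonneg w))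
    (y := z + w) (by simp)
  · simpa using h
  · refine (hb x).trans ?_
    rw [mul_assoc, ← Real.exp_add]
    gcongr
    rw [mem_closedBall_iff_norm] at hx
    have h1 : ‖z‖ ≤ ‖x‖ + 1 := by
      have := norm_le_insert x z
      linarith
    have h2 : ‖z‖ ^ 2 ≤ (‖x‖ + 1) ^ 2 := by gcongr
    nlinarith [sq_nonneg (‖x‖ - 1)]

/-- Pointwise-in-time estimates for the increments of a second derivative of the heat flow at
scale `r`, gaining two, respectively three, powers of `r`. -/
lemma exists_heat_increment_bound (d : ℕ) {α : ℝ} (hα : 0 < α) (hα1 : α < 1)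
    {e : EuclideanSpace ℝ (Fin d)} (he : ‖e‖ = 1) :
    ∃ C : ℝ, 0 ≤ C ∧ ∀ (φ : EuclideanSpace ℝ (Fin d) → ℝ) (B M : ℝ),
      ContDiff ℝ (⊤ : ℕ∞) φ → (∀ y, |φ y| ≤ B) → (∀ y, |fderiv ℝ φ y e| ≤ B) →
      (∀ y, |fderiv ℝ (fun y => fderiv ℝ φ y e) y e| ≤ B) → 0 ≤ M →
      (∀ x y, |φ x - φ y| ≤ M * ‖x - y‖ ^ α) →
      ∀ (r : ℝ) (x h : EuclideanSpace ℝ (Fin d)), 0 < r →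
        |(∫ z, heatKernel d 1 z * fderiv ℝ (fun y => fderiv ℝ φ y e) (x + h - r • z) e) -
          ∫ z, heatKernel d 1 z * fderiv ℝ (fun y => fderiv ℝ φ y e) (x - r • z) e| ≤
            C * M * r ^ (α - 2) ∧
        (‖h‖ ≤ r →
          |(∫ z, heatKernel d 1 z * fderiv ℝ (fun y => fderiv ℝ φ y e) (x + h - r • z) e) -
          ∫ z, heatKernel d 1 z * fderiv ℝ (fun y => fderiv ℝ φ y e) (x - r • z) e| ≤
            C * M * (‖h‖ * r ^ (α - 3))) := by
  obtain ⟨g₁, g₂, K, hK, hgd, hg1d, hg2d, hg1, hg2, hgb, hg1b, hg2b, hg3b⟩ :=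
    exists_heatKernel_one_deriv d he
  obtain ⟨I, hI⟩ : ∃ I, I = ∫ z : EuclideanSpace ℝ (Fin d),
    ‖z‖ ^ α * Real.exp (-(1 / 16) * ‖z‖ ^ 2) := ⟨_, rfl⟩
  have hIint := integrable_norm_rpow_mul_exp d (α := α) (b := 1 / 16) hα.le (by linarith)
    (by norm_num)
  have hI0 : 0 ≤ I := hI ▸ integral_nonneg fun z => by positivity
  have hgi := hgd.integrable_of_le_gaussian hgb
  have hg1i := hg1d.integrable_of_le_gaussian hg1b
  have hg2i := hg2d.integrable_of_le_gaussian hg2b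
  have hE : 1 ≤ Real.exp (1 / 8) := Real.one_le_exp (by norm_num)
  refine ⟨2 * (K * Real.exp (1 / 8)) * I, by positivity,
    fun φ B M hφ hB hB1 hB2 hM hH r x h hr => ?_⟩
  have hφ1 : ContDiff ℝ 1 φ := hφ.of_le (by exact_mod_cast le_top)
  have hφ2 : ContDiff ℝ 1 (fun y => fderiv ℝ φ y e) :=
    ((contDiff_infty_iff_fderiv.mp hφ).2.of_le (by exact_mod_cast le_top)).clm_apply contDiff_const
  have hcφ := hφ.continuous
  have hcg2 := hg2d.continuous
  have key : ∀ x, ∫ z, heatKernel d 1 z * fderiv ℝ (fun y => fderiv ℝ φ y e) (x - r • z) e =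
      r⁻¹ * (r⁻¹ * ∫ z, g₂ z * φ (x - r • z)) := by
    intro x
    rw [integral_mul_fderiv_comp d hr e hgd hgi (by simpa only [hg1] using hg1i) hφ2 hB1 hB2 x]
    simp only [hg1]
    rw [integral_mul_fderiv_comp d hr e hg1d hg1i (by simpa only [hg2] using hg2i) hφ1 hB hB1 x]
    simp only [hg2]
  have hint : ∀ x y, Integrable fun z => g₂ (z + y) * φ (x - r • z) := fun x y =>
    (hg2i.comp_add_right y).mul_bdd (c := B) (by fun_prop)
      (Filter.Eventually.of_forall fun z => hB _)
  have hzero : ∫ z, g₂ z = 0 := by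
    have := integral_mul_fderiv_comp d hr e hg1d hg1i (by simpa only [hg2] using hg2i)
      (contDiff_const (c := (1 : ℝ))) (B := 1) (by simp) (by simp) 0
    simp only [hg2] at this
    simp [hr.ne'] at this
    exact this
  have hzero' : ∀ w, ∫ z, g₂ (z + w) = 0 := fun w => by rw [integral_add_right_eq_self, hzero]
  -- a kernel with zero mean and Gaussian decay sees only the oscillation of `φ`
  have bound : ∀ (k : EuclideanSpace ℝ (Fin d) → ℝ) (L : ℝ) (x : EuclideanSpace ℝ (Fin d)),
      Integrable k → (∫ z, k z = 0) → 0 ≤ L →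
      (∀ z, |k z| ≤ L * Real.exp (-(1 / 16) * ‖z‖ ^ 2)) →
      |∫ z, k z * φ (x - r • z)| ≤ L * M * r ^ α * I := by
    intro k L x hk hk0 hL hkb
    have e1 : ∫ z, k z * φ (x - r • z) = ∫ z, k z * (φ (x - r • z) - φ x) := by
      simp only [mul_sub]
      rw [integral_sub (hk.mul_bdd (c := B) (by fun_prop)
        (Filter.Eventually.of_forall fun z => hB _)) (hk.mul_const _), integral_mul_const, hk0]
      simp
    rw [e1, hI, ← integral_const_mul]
    rw [← Real.norm_eq_abs]
    refine norm_integral_le_of_norm_le (hIint.const_mul _) (Filter.Eventually.of_forall fun z => ?_)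
    rw [norm_mul, Real.norm_eq_abs, Real.norm_eq_abs]
    have e2 := hH (x - r • z) x
    rw [sub_sub_cancel_left, norm_neg, norm_smul, Real.norm_of_nonneg hr.le,
      Real.mul_rpow hr.le (norm_nonneg _)] at e2
    calc |k z| * |φ (x - r • z) - φ x|
        ≤ (L * Real.exp (-(1 / 16) * ‖z‖ ^ 2)) * (M * (r ^ α * ‖z‖ ^ α)) := by
          gcongr
          exact hkb z
      _ = _ := by ring
  have r2 : r ^ (α - 2) = r⁻¹ * (r⁻¹ * r ^ α) := by
    rw [Real.rpow_sub hr, Real.rpow_two]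
    field_simp
  have r3 : r ^ (α - 3) = r⁻¹ * (r⁻¹ * (r⁻¹ * r ^ α)) := by
    rw [Real.rpow_sub hr, show (3 : ℝ) = (3 : ℕ) by norm_num, Real.rpow_natCast]
    field_simp
  rw [key, key, ← mul_sub, ← mul_sub, abs_mul, abs_mul, abs_of_pos (inv_pos.mpr hr)]
  have hri : 0 < r⁻¹ := inv_pos.mpr hr
  have hrα : 0 ≤ r ^ α := by positivity
  constructor
  · have b1 : ∀ x, |∫ z, g₂ z * φ (x - r • z)| ≤ K * Real.exp (1 / 8) * M * r ^ α * I := fun x =>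
      bound g₂ (K * Real.exp (1 / 8)) x hg2i hzero (by positivity) fun z => (hg2b z).trans (by
        have : Real.exp (-(1 / 8) * ‖z‖ ^ 2) ≤ Real.exp (-(1 / 16) * ‖z‖ ^ 2) := by
          gcongr; norm_num
        gcongr
        nlinarith)
    have b2 := (abs_sub _ _).trans (add_le_add (b1 (x + h)) (b1 x))
    rw [r2]
    refine (mul_le_mul_of_nonneg_left (mul_le_mul_of_nonneg_left b2 hri.le) hri.le).trans_eq ?_
    ring
  · intro hh
    set w := r⁻¹ • h with hw
    have hwn : ‖w‖ = r⁻¹ * ‖h‖ := by rw [hw, norm_smul, Real.norm_of_nonneg hri.le]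
    have hw1 : ‖w‖ ≤ 1 := by
      rw [hwn, inv_mul_le_iff₀ hr]
      simpa using hh
    have hshift : ∫ z, g₂ z * φ (x + h - r • z) = ∫ z, g₂ (z + w) * φ (x - r • z) := by
      rw [← integral_add_right_eq_self _ w]
      congr 1 with z
      congr 2
      rw [smul_add, hw, smul_inv_smul₀ hr.ne']
      abel
    have hdiff : (∫ z, g₂ z * φ (x + h - r • z)) - ∫ z, g₂ z * φ (x - r • z) =
        ∫ z, (g₂ (z + w) - g₂ z) * φ (x - r • z) := by
      rw [hshift, ← integral_sub (hint x w) (by simpa using hint x 0)]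
      congr 1 with z
      ring
    have b2 := bound (fun z => g₂ (z + w) - g₂ z) (K * Real.exp (1 / 8) * ‖w‖) x
      ((hg2i.comp_add_right w).sub hg2i)
      (by rw [integral_sub (hg2i.comp_add_right w) hg2i, hzero', hzero, sub_zero])
      (by positivity)
      (fun z => (abs_sub_le_gaussian hK hg2d hg3b z w hw1).trans_eq (by ring))
    rw [hdiff, r3]
    refine (mul_le_mul_of_nonneg_left (mul_le_mul_of_nonneg_left b2 hri.le) hri.le).trans ?_
    calc r⁻¹ * (r⁻¹ * (K * Real.exp (1 / 8) * ‖w‖ * M * r ^ α * I))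
        = K * Real.exp (1 / 8) * I * M * (‖h‖ * (r⁻¹ * (r⁻¹ * (r⁻¹ * r ^ α)))) := by
          rw [hwn]
          ring
      _ ≤ _ := by
        have : 0 ≤ K * Real.exp (1 / 8) * I * M * (‖h‖ * (r⁻¹ * (r⁻¹ * (r⁻¹ * r ^ α)))) := by
          positivity
        linarith

/-- First-order differentiation under the integral sign for a dominated family. -/
lemma fderiv_integral_of_dominated {X : Type*} [MeasurableSpace X] {μ : Measure X} {d : ℕ}
    {F : X → EuclideanSpace ℝ (Fin d) → ℝ} {b : X → ℝ} (hb : Integrable b μ)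
    (hm : ∀ x, AEStronglyMeasurable (fun a => F a x) μ) (hd : ∀ a, Differentiable ℝ (F a))
    (h0 : ∀ a x, |F a x| ≤ b a) (h1 : ∀ a x, ‖fderiv ℝ (F a) x‖ ≤ b a)
    (x v : EuclideanSpace ℝ (Fin d)) :
    AEStronglyMeasurable (fun a => fderiv ℝ (F a) x v) μ ∧
      fderiv ℝ (fun y => ∫ a, F a y ∂μ) x v = ∫ a, fderiv ℝ (F a) x v ∂μ := by
  have hdir : ∀ v, AEStronglyMeasurable (fun a => fderiv ℝ (F a) x v) μ := by
    intro v
    refine aestronglyMeasurable_of_tendsto_ae Filter.atTop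
      (f := fun (n : ℕ) a => (n : ℝ) • (F a (x + (n : ℝ)⁻¹ • v) - F a x))
      (fun n => ((hm (x + (n : ℝ)⁻¹ • v)).sub (hm x)).const_smul (n : ℝ))
      (Filter.Eventually.of_forall fun a => ?_)
    refine (hd a x).hasFDerivAt.lim_real v |>.comp tendsto_natCast_atTop_atTop
  have hmeas : AEStronglyMeasurable (fun a => fderiv ℝ (F a) x) μ := by
    have : (fun a => fderiv ℝ (F a) x) = fun a => ∑ j,
        fderiv ℝ (F a) x (EuclideanSpace.single j 1) • EuclideanSpace.proj (𝕜 := ℝ) j := by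
      ext a w
      conv_lhs => rw [← (EuclideanSpace.basisFun (Fin d) ℝ).sum_repr w]
      simp [mul_comm]
    rw [this]
    refine Finset.aestronglyMeasurable_fun_sum _ fun j _ => ?_
    exact (hdir _).smul_const _
  have hint : Integrable (fun a => fderiv ℝ (F a) x) μ :=
    hb.mono' hmeas (Filter.Eventually.of_forall fun a => h1 a x)
  have h := hasFDerivAt_integral_of_dominated_of_fderiv_le (μ := μ) (x₀ := x)
    (F := fun y a => F a y) (F' := fun y a => fderiv ℝ (F a) y) (bound := b) Filter.univ_mem
    (Filter.Eventually.of_forall hm)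
    (hb.mono' (hm x) (Filter.Eventually.of_forall fun a => h0 a x)) hmeas
    (Filter.Eventually.of_forall fun a y _ => h1 a y) hb
    (Filter.Eventually.of_forall fun a y _ => (hd a y).hasFDerivAt)
  exact ⟨hdir v, by rw [h.fderiv, ContinuousLinearMap.integral_apply hint]⟩

/-- The time profile of the increments has integral of order `a ^ α`. -/
lemma integral_time_profile {α a : ℝ} (hα : 0 < α) (hα1 : α < 1) (ha : 0 < a) :
    IntegrableOn (fun σ : ℝ => if σ ≤ a ^ 2 then √σ ^ (α - 2) else a * √σ ^ (α - 3)) (Ioi 0) ∧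
    ∫ σ in Ioi (0 : ℝ), (if σ ≤ a ^ 2 then √σ ^ (α - 2) else a * √σ ^ (α - 3)) =
      (2 / α + 2 / (1 - α)) * a ^ α := by
  have ha2 : 0 < a ^ 2 := by positivity
  have hU : Ioi (0 : ℝ) = Ioc 0 (a ^ 2) ∪ Ioi (a ^ 2) := (Ioc_union_Ioi_eq_Ioi ha2.le).symm
  have hsq : ∀ p : ℝ, ∀ σ : ℝ, 0 < σ → √σ ^ p = σ ^ (p / 2) := fun p σ hσ => by
    rw [Real.sqrt_eq_rpow, ← Real.rpow_mul hσ.le]; ring_nf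
  have e1 : EqOn (fun σ : ℝ => if σ ≤ a ^ 2 then √σ ^ (α - 2) else a * √σ ^ (α - 3))
      (fun σ => σ ^ ((α - 2) / 2)) (Ioc 0 (a ^ 2)) := fun σ hσ => by
    simp only [if_pos hσ.2, hsq _ σ hσ.1]
  have e2 : EqOn (fun σ : ℝ => if σ ≤ a ^ 2 then √σ ^ (α - 2) else a * √σ ^ (α - 3))
      (fun σ => a * σ ^ ((α - 3) / 2)) (Ioi (a ^ 2)) := fun σ hσ => by
    simp only [if_neg (not_le.mpr (mem_Ioi.mp hσ)), hsq _ σ (ha2.trans hσ)]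
  have i1 : IntegrableOn (fun σ : ℝ => σ ^ ((α - 2) / 2)) (Ioc 0 (a ^ 2)) :=
    (intervalIntegral.intervalIntegrable_rpow' (by linarith)).1
  have i2 : IntegrableOn (fun σ : ℝ => a * σ ^ ((α - 3) / 2)) (Ioi (a ^ 2)) :=
    (integrableOn_Ioi_rpow_of_lt (by linarith) ha2).const_mul a
  have i1' := (integrableOn_congr_fun e1 measurableSet_Ioc).mpr i1
  have i2' := (integrableOn_congr_fun e2 measurableSet_Ioi).mpr i2
  have hpow : ∀ p : ℝ, (a ^ 2) ^ p = a ^ (2 * p) := fun p => by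
    rw [← Real.rpow_two, ← Real.rpow_mul ha.le]
  refine ⟨hU ▸ i1'.union i2', ?_⟩
  rw [hU, setIntegral_union (Set.Ioc_disjoint_Ioi le_rfl) measurableSet_Ioi i1' i2',
    setIntegral_congr_fun measurableSet_Ioc e1, setIntegral_congr_fun measurableSet_Ioi e2,
    integral_const_mul, integral_Ioi_rpow_of_lt (by linarith) ha2,
    ← intervalIntegral.integral_of_le ha2.le, integral_rpow (Or.inl (by linarith)), hpow, hpow,
    Real.zero_rpow (by linarith)]
  have p1 : 2 * ((α - 2) / 2 + 1) = α := by ring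
  have p2 : a * a ^ (2 * ((α - 3) / 2 + 1)) = a ^ α := by
    conv_lhs => rw [← Real.rpow_one a, ← Real.rpow_mul ha.le, ← Real.rpow_add ha]
    congr 1; ring
  have hα' : 1 - α ≠ 0 := by linarith
  have hα'' : (α - 3) / 2 + 1 ≠ 0 := by intro h; apply hα'; linarith
  rw [p1, show (α - 2) / 2 + 1 = α / 2 by ring, mul_div_assoc', mul_neg, p2,
    show (α - 3) / 2 + 1 = -((1 - α) / 2) by ring]
  field_simp
  ring

lemma integral_comp_mul_sub_le {Φ : ℝ → ℝ} (hΦ : IntegrableOn Φ (Ioi 0)) (h0 : ∀ σ, 0 ≤ Φ σ)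
    {ν : ℝ} (hν : 0 < ν) (t : ℝ) :
    IntegrableOn (fun τ => Φ (ν * (t - τ))) (Ioo 0 t) ∧
      ν * ∫ τ in Ioo 0 t, Φ (ν * (t - τ)) ≤ ∫ σ in Ioi 0, Φ σ := by
  set G : ℝ → ℝ := (Ioi 0).indicator fun s => Φ (ν * s) with hG
  have hi : IntegrableOn (fun s => Φ (ν * s)) (Ioi 0) :=
    (integrableOn_Ioi_comp_mul_left_iff Φ 0 hν).mpr (by simpa using hΦ)
  have hGi : Integrable G := (integrable_indicator_iff measurableSet_Ioi).mpr hi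
  have hGt : Integrable (fun τ => G (t - τ)) := hGi.comp_sub_left t
  have heq : EqOn (fun τ => G (t - τ)) (fun τ => Φ (ν * (t - τ))) (Ioo 0 t) := fun τ hτ => by
    simp only [hG]
    rw [indicator_of_mem (mem_Ioi.mpr (sub_pos.mpr hτ.2))]
  have hG0 : ∀ s, 0 ≤ G s := fun s => indicator_nonneg (fun _ _ => h0 _) s
  refine ⟨(integrableOn_congr_fun heq measurableSet_Ioo).mp hGt.integrableOn, ?_⟩
  rw [← setIntegral_congr_fun measurableSet_Ioo heq]
  calc ν * ∫ τ in Ioo 0 t, G (t - τ) ≤ ν * ∫ τ, G (t - τ) := by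
        exact mul_le_mul_of_nonneg_left
          (setIntegral_le_integral hGt (Filter.Eventually.of_forall fun τ => hG0 _)) hν.le
    _ = ∫ σ in Ioi 0, Φ σ := by
        rw [integral_sub_left_eq_self G volume t, hG, integral_indicator measurableSet_Ioi,
          integral_comp_mul_left_Ioi Φ 0 hν, mul_zero, smul_eq_mul, mul_inv_cancel_left₀ hν.ne']

lemma heatKernel_sqrt_smul {d : ℕ} {s : ℝ} (hs : 0 < s) (z : EuclideanSpace ℝ (Fin d)) :
    heatKernel d s (√s • z) = (√s ^ d)⁻¹ * heatKernel d 1 z := by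
  unfold heatKernel
  have h1 : (√s ^ d)⁻¹ = s ^ (-(d : ℝ) / 2) := by
    rw [Real.sqrt_eq_rpow, ← Real.rpow_natCast, ← Real.rpow_mul hs.le, ← Real.rpow_neg hs.le]
    congr 1; ring
  rw [h1, norm_smul, mul_pow, Real.norm_of_nonneg (Real.sqrt_nonneg s), Real.sq_sqrt hs.le,
    mul_one, Real.mul_rpow (by positivity) hs.le]
  have h2 : -(s * ‖z‖ ^ 2) / (4 * s) = -‖z‖ ^ 2 / (4 * 1) := by field_simp
  rw [h2]
  ring

lemma integral_heatKernel_mul_eq {d : ℕ} {s : ℝ} (hs : 0 < s) (φ : EuclideanSpace ℝ (Fin d) → ℝ)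
    (x : EuclideanSpace ℝ (Fin d)) :
    ∫ y, heatKernel d s y * φ (x - y) = ∫ z, heatKernel d 1 z * φ (x - √s • z) := by
  have hp : 0 < √s ^ d := by positivity
  have h := Measure.integral_comp_smul volume (fun y => heatKernel d s y * φ (x - y)) (√s)
  simp only [heatKernel_sqrt_smul hs, finrank_euclideanSpace_fin, mul_assoc, smul_eq_mul,
    abs_of_pos (inv_pos.mpr hp), integral_const_mul] at h
  exact (mul_left_cancel₀ (inv_pos.mpr hp).ne' h).symm

lemma integrable_heatKernel_one (d : ℕ) : Integrable (heatKernel d 1) := by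
  obtain ⟨K, -, hb⟩ := exists_heatKernel_one_le d 0
  refine Differentiable.integrable_of_le_gaussian (K := K)
    (fun z => (hasFDerivAt_heatKernel_one d z).differentiableAt) fun z => le_trans ?_ (hb z)
  have := heatKernel_one_nonneg d z
  rw [abs_of_nonneg this, pow_zero]
  linarith

lemma hasFDerivAt_const_mul_comp_sub {d : ℕ} {φ : EuclideanSpace ℝ (Fin d) → ℝ}
    (hφ : Differentiable ℝ φ) (c : ℝ) (s x : EuclideanSpace ℝ (Fin d)) :
    HasFDerivAt (fun x => c * φ (x - s)) (c • fderiv ℝ φ (x - s)) x := by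
  have h := (hφ (x - s)).hasFDerivAt.comp x ((hasFDerivAt_id x).sub_const s)
  simpa using h.const_mul c

/-- Differentiating the Duhamel integral twice in the direction `e` moves both derivatives onto
the forcing. -/
lemma fderiv_fderiv_duhamel {d : ℕ} {f : ℝ → EuclideanSpace ℝ (Fin d) → ℝ} {B : ℝ}
    {e : EuclideanSpace ℝ (Fin d)} (he : ‖e‖ = 1)
    (hc : Continuous fun q : ℝ × EuclideanSpace ℝ (Fin d) => f q.1 q.2)
    (hs : ∀ τ, ContDiff ℝ (⊤ : ℕ∞) (f τ)) (hB : ∀ τ x, |f τ x| ≤ B)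
    (hB1 : ∀ τ x, ‖fderiv ℝ (f τ) x‖ ≤ B)
    (hB2 : ∀ τ x, ‖fderiv ℝ (fun y => fderiv ℝ (f τ) y e) x‖ ≤ B) (r : ℝ → ℝ) (hr : Continuous r)
    (t : ℝ) (x : EuclideanSpace ℝ (Fin d)) :
    let μ : Measure (ℝ × EuclideanSpace ℝ (Fin d)) := (volume.restrict (Ioo 0 t)).prod volume
    Integrable (fun p => heatKernel d 1 p.2 * f p.1 (x - r p.1 • p.2)) μ ∧
    Integrable (fun p => heatKernel d 1 p.2 *
      fderiv ℝ (fun y => fderiv ℝ (f p.1) y e) (x - r p.1 • p.2) e) μ ∧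
    fderiv ℝ (fun y => fderiv ℝ
      (fun w => ∫ p, heatKernel d 1 p.2 * f p.1 (w - r p.1 • p.2) ∂μ) y e) x e =
      ∫ p, heatKernel d 1 p.2 *
        fderiv ℝ (fun y => fderiv ℝ (f p.1) y e) (x - r p.1 • p.2) e ∂μ := by
  intro μ
  have hgc : Continuous (heatKernel d 1) := by unfold heatKernel; fun_prop
  have hg0 := heatKernel_one_nonneg d
  have hbi : Integrable (fun p : ℝ × EuclideanSpace ℝ (Fin d) => heatKernel d 1 p.2 * B) μ :=
    ((integrable_heatKernel_one d).comp_snd _).mul_const B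
  have d0 : ∀ τ, Differentiable ℝ (f τ) := fun τ => (hs τ).differentiable (by simp)
  have d1 : ∀ τ, Differentiable ℝ (fun y => fderiv ℝ (f τ) y e) := fun τ =>
    ((contDiff_infty_iff_fderiv.mp (hs τ)).2.clm_apply contDiff_const).differentiable (by simp)
  have hm0 : ∀ x, AEStronglyMeasurable
      (fun p : ℝ × EuclideanSpace ℝ (Fin d) => heatKernel d 1 p.2 * f p.1 (x - r p.1 • p.2)) μ := by
    intro x
    have : Continuous fun p : ℝ × EuclideanSpace ℝ (Fin d) => f p.1 (x - r p.1 • p.2) :=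
      hc.comp (continuous_fst.prodMk (continuous_const.sub
        ((hr.comp continuous_fst).smul continuous_snd)))
    exact ((hgc.comp continuous_snd).mul this).aestronglyMeasurable
  have habs : ∀ (p : ℝ × EuclideanSpace ℝ (Fin d)) (b : ℝ), |b| ≤ B →
      |heatKernel d 1 p.2 * b| ≤ heatKernel d 1 p.2 * B := fun p b hb => by
    rw [abs_mul, abs_of_nonneg (hg0 _)]
    exact mul_le_mul_of_nonneg_left hb (hg0 _)
  have hnorm : ∀ (p : ℝ × EuclideanSpace ℝ (Fin d)) (L : EuclideanSpace ℝ (Fin d) →L[ℝ] ℝ),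
      ‖L‖ ≤ B → ‖heatKernel d 1 p.2 • L‖ ≤ heatKernel d 1 p.2 * B := fun p L hb => by
    rw [norm_smul, Real.norm_of_nonneg (hg0 _)]
    exact mul_le_mul_of_nonneg_left hb (hg0 _)
  have happ : ∀ L : EuclideanSpace ℝ (Fin d) →L[ℝ] ℝ, ‖L‖ ≤ B → |L e| ≤ B := fun L hL => by
    have := L.le_opNorm e
    rw [he, mul_one] at this
    exact this.trans hL
  have fd0 := fun (p : ℝ × EuclideanSpace ℝ (Fin d)) x =>
    hasFDerivAt_const_mul_comp_sub (d0 p.1) (heatKernel d 1 p.2) (r p.1 • p.2) x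
  have fd1 := fun (p : ℝ × EuclideanSpace ℝ (Fin d)) x =>
    hasFDerivAt_const_mul_comp_sub (d1 p.1) (heatKernel d 1 p.2) (r p.1 • p.2) x
  have s0 := fun x => fderiv_integral_of_dominated hbi hm0 (fun p x => (fd0 p x).differentiableAt)
    (fun p x => habs p _ (hB _ _)) (fun p x => by rw [(fd0 p x).fderiv]; exact hnorm p _ (hB1 _ _))
    x e
  simp only [fun p x => (fd0 p x).fderiv, smul_apply, smul_eq_mul] at s0
  have s1 := fderiv_integral_of_dominated hbi (fun x => (s0 x).1)
    (fun p x => (fd1 p x).differentiableAt)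
    (fun p x => habs p _ (happ _ (hB1 _ _)))
    (fun p x => by rw [(fd1 p x).fderiv]; exact hnorm p _ (hB2 _ _)) x e
  simp only [fun p x => (fd1 p x).fderiv, smul_apply, smul_eq_mul] at s1
  refine ⟨hbi.mono' (hm0 x) (Filter.Eventually.of_forall fun p => habs p _ (hB _ _)),
    hbi.mono' s1.1 (Filter.Eventually.of_forall fun p => habs p _ (happ _ (hB2 _ _))), ?_⟩
  rw [← s1.2]
  congr 2 with y
  exact (s0 y).2

lemma norm_fderiv_fderiv_apply_le {d : ℕ} {φ : EuclideanSpace ℝ (Fin d) → ℝ}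
    (hφ : ContDiff ℝ (⊤ : ℕ∞) φ) {e : EuclideanSpace ℝ (Fin d)} (he : ‖e‖ = 1)
    (x : EuclideanSpace ℝ (Fin d)) :
    ‖fderiv ℝ (fun y => fderiv ℝ φ y e) x‖ ≤ ‖iteratedFDeriv ℝ 2 φ x‖ := by
  have hd : DifferentiableAt ℝ (fderiv ℝ φ) x :=
    (contDiff_infty_iff_fderiv.mp hφ).2.differentiable (by simp) x
  have h2 : ‖iteratedFDeriv ℝ 2 φ x‖ = ‖fderiv ℝ (fderiv ℝ φ) x‖ := by
    rw [← norm_iteratedFDeriv_one, norm_iteratedFDeriv_fderiv]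
  rw [h2, (hd.hasFDerivAt.clm_apply (hasFDerivAt_const e x)).fderiv]
  refine ContinuousLinearMap.opNorm_le_bound _ (norm_nonneg (fderiv ℝ (fderiv ℝ φ) x)) fun v => ?_
  simp only [ContinuousLinearMap.comp_zero, zero_add, ContinuousLinearMap.flip_apply]
  calc _ ≤ ‖fderiv ℝ (fderiv ℝ φ) x v‖ * ‖e‖ := ContinuousLinearMap.le_opNorm _ _
    _ ≤ _ := by rw [he, mul_one]; exact ContinuousLinearMap.le_opNorm _ _

/-- The estimate for one pure second derivative of the Duhamel integral. -/
lemma exists_duhamel_increment_bound (d : ℕ) {α : ℝ} (hα : 0 < α) (hα1 : α < 1)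
    {e : EuclideanSpace ℝ (Fin d)} (he : ‖e‖ = 1) :
    ∃ C : ℝ, 0 ≤ C ∧ ∀ (f : ℝ → EuclideanSpace ℝ (Fin d) → ℝ) (B M ν : ℝ), 0 < ν →
      (Continuous fun q : ℝ × EuclideanSpace ℝ (Fin d) => f q.1 q.2) →
      (∀ τ, ContDiff ℝ (⊤ : ℕ∞) (f τ)) → (∀ τ x, |f τ x| ≤ B) →
      (∀ τ x, ‖fderiv ℝ (f τ) x‖ ≤ B) →
      (∀ τ x, ‖fderiv ℝ (fun y => fderiv ℝ (f τ) y e) x‖ ≤ B) → 0 ≤ M →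
      (∀ τ x y, |f τ x - f τ y| ≤ M * ‖x - y‖ ^ α) →
      ∀ (t : ℝ) (x h : EuclideanSpace ℝ (Fin d)), h ≠ 0 →
      let D := fun x => fderiv ℝ (fun y => fderiv ℝ (fun w => ∫ p, heatKernel d 1 p.2 *
        f p.1 (w - √(ν * (t - p.1)) • p.2) ∂((volume.restrict (Ioo 0 t)).prod volume)) y e) x e
      ν * |D (x + h) - D x| ≤ C * M * ‖h‖ ^ α := by
  obtain ⟨C, hC, hinc⟩ := exists_heat_increment_bound d hα hα1 he
  have h1α : 0 < 1 - α := by linarith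
  refine ⟨C * (2 / α + 2 / (1 - α)), by positivity,
    fun f B M ν hν hc hs hB hB1 hB2 hM hH t x h hh => ?_⟩
  intro D
  have ha : 0 < ‖h‖ := norm_pos_iff.mpr hh
  have hr : Continuous fun τ => √(ν * (t - τ)) := by fun_prop
  have hD := fun x => fderiv_fderiv_duhamel he hc hs hB hB1 hB2 _ hr t x
  have hDx : ∀ x, D x = ∫ τ in Ioo 0 t, ∫ z, heatKernel d 1 z *
      fderiv ℝ (fun y => fderiv ℝ (f τ) y e) (x - √(ν * (t - τ)) • z) e := fun x =>
    (hD x).2.2.trans (integral_prod _ (hD x).2.1)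
  obtain ⟨hΦi, hΦ⟩ := integral_time_profile hα hα1 ha
  set Φ : ℝ → ℝ := fun σ => if σ ≤ ‖h‖ ^ 2 then √σ ^ (α - 2) else ‖h‖ * √σ ^ (α - 3) with hΦdef
  have hΦ0 : ∀ σ, 0 ≤ Φ σ := fun σ => by
    simp only [hΦdef]
    split_ifs <;> positivity
  obtain ⟨hi, hle⟩ := integral_comp_mul_sub_le hΦi hΦ0 hν t
  have habs1 : ∀ τ y, |fderiv ℝ (f τ) y e| ≤ B := fun τ y => by
    have := (fderiv ℝ (f τ) y).le_opNorm e
    rw [he, mul_one] at this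
    exact this.trans (hB1 τ y)
  have habs2 : ∀ τ y, |fderiv ℝ (fun y => fderiv ℝ (f τ) y e) y e| ≤ B := fun τ y => by
    have := (fderiv ℝ (fun y => fderiv ℝ (f τ) y e) y).le_opNorm e
    rw [he, mul_one] at this
    exact this.trans (hB2 τ y)
  have hstep : |D (x + h) - D x| ≤ ∫ τ in Ioo 0 t, C * M * Φ (ν * (t - τ)) := by
    rw [hDx, hDx, ← integral_sub (hD (x + h)).2.1.integral_prod_left (hD x).2.1.integral_prod_left,
      ← Real.norm_eq_abs]
    refine norm_integral_le_of_norm_le (hi.const_mul _)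
      ((ae_restrict_iff' measurableSet_Ioo).mpr (Filter.Eventually.of_forall fun τ hτ => ?_))
    have hpos : 0 < ν * (t - τ) := mul_pos hν (sub_pos.mpr hτ.2)
    obtain ⟨b1, b2⟩ := hinc (f τ) B M (hs τ) (hB τ) (habs1 τ) (habs2 τ) hM (hH τ)
      (√(ν * (t - τ))) x h (Real.sqrt_pos.mpr hpos)
    rw [Real.norm_eq_abs]
    simp only [hΦdef]
    split_ifs with hcase
    · exact b1
    · exact b2 (Real.le_sqrt_of_sq_le (not_le.mp hcase).le)
  rw [integral_const_mul] at hstep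
  calc ν * |D (x + h) - D x| ≤ ν * (C * M * ∫ τ in Ioo 0 t, Φ (ν * (t - τ))) := by gcongr
    _ = C * M * (ν * ∫ τ in Ioo 0 t, Φ (ν * (t - τ))) := by ring
    _ ≤ C * M * ((2 / α + 2 / (1 - α)) * ‖h‖ ^ α) := by
      rw [hΦ] at hle
      gcongr
    _ = _ := by ring

/-- viscosity-independent spatial Hölder estimate for `ν Δ u`, where `u` is
the Duhamel integral of the forcing `f` against the heat semigroup. -/
theorem stmt12 (d : ℕ) (hd : 1 ≤ d) (α : ℝ) (hα : 0 < α) (hα1 : α < 1) :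
    ∃ C : ℝ, 0 < C ∧
      ∀ ν T : ℝ, 0 < ν → 0 < T →
      ∀ (f : ℝ → (EuclideanSpace ℝ (Fin d)) → ℝ) (M : ℝ),
        ContinuousOn (fun q : ℝ × (EuclideanSpace ℝ (Fin d)) => f q.1 q.2) (Icc 0 T ×ˢ univ) →
        (∃ B : ℝ, ∀ t ∈ Icc (0 : ℝ) T, ∀ x, |f t x| ≤ B) →
        (∀ t ∈ Icc (0 : ℝ) T, ContDiff ℝ (⊤ : ℕ∞) (fun x => f t x)) →
        (∀ n : ℕ, ∃ B : ℝ, ∀ t ∈ Icc (0 : ℝ) T, ∀ x,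
          ‖iteratedFDeriv ℝ n (fun y => f t y) x‖ ≤ B) →
        (∀ t ∈ Icc (0 : ℝ) T, ∀ x y, |f t x - f t y| ≤ M * ‖x - y‖ ^ α) →
        ∀ u : ℝ → (EuclideanSpace ℝ (Fin d)) → ℝ,
          (∀ t x, u t x = ∫ τ in (0 : ℝ)..t, ∫ y, heatKernel d (ν * (t - τ)) y * f τ (x - y)) →
          ∀ t ∈ Ioc (0 : ℝ) T, ∀ x h : (EuclideanSpace ℝ (Fin d)),
            ν * |lap d (u t) (x + h) - lap d (u t) x| ≤ C * M * ‖h‖ ^ α := by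
  have he : ∀ j : Fin d, ‖EuclideanSpace.single j (1 : ℝ)‖ = 1 := fun j => by simp
  choose C hC hbound using fun j => exists_duhamel_increment_bound d hα hα1 (he j)
  have hC0 : 0 ≤ ∑ j, C j := Finset.sum_nonneg fun j _ => hC j
  refine ⟨(∑ j, C j) + 1, by linarith, ?_⟩
  intro ν T hν hT f M hcont hbdd hsm hder hhol u hu t ht x h
  have hM : 0 ≤ M := by
    have := hhol 0 ⟨le_rfl, hT.le⟩ (EuclideanSpace.single ⟨0, hd⟩ 1) 0
    rw [sub_zero, he, Real.one_rpow, mul_one] at this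
    exact (abs_nonneg _).trans this
  rcases eq_or_ne h 0 with rfl | hh
  · simp [Real.zero_rpow hα.ne']
  set F : ℝ → EuclideanSpace ℝ (Fin d) → ℝ := fun τ => f (projIcc 0 T hT.le τ) with hF
  have hmem : ∀ τ, (projIcc 0 T hT.le τ : ℝ) ∈ Icc 0 T := fun τ => (projIcc 0 T hT.le τ).2
  have hFc : Continuous fun q : ℝ × EuclideanSpace ℝ (Fin d) => F q.1 q.2 :=
    hcont.comp_continuous (f := fun q : ℝ × EuclideanSpace ℝ (Fin d) =>
      ((projIcc 0 T hT.le q.1 : ℝ), q.2))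
      ((continuous_subtype_val.comp (continuous_projIcc.comp continuous_fst)).prodMk
        continuous_snd) fun q => ⟨hmem _, mem_univ _⟩
  obtain ⟨B₀, hB₀⟩ := hbdd
  obtain ⟨B₁, hB₁⟩ := hder 1
  obtain ⟨B₂, hB₂⟩ := hder 2
  set B := max B₀ (max B₁ B₂)
  have hFs : ∀ τ, ContDiff ℝ (⊤ : ℕ∞) (F τ) := fun τ => hsm _ (hmem τ)
  have h0 : ∀ τ x, |F τ x| ≤ B := fun τ x => (hB₀ _ (hmem τ) x).trans (le_max_left _ _)
  have h1 : ∀ τ x, ‖fderiv ℝ (F τ) x‖ ≤ B := fun τ x => by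
    rw [← norm_iteratedFDeriv_one]
    exact (hB₁ _ (hmem τ) x).trans ((le_max_left _ _).trans (le_max_right _ _))
  have h2 : ∀ j τ x,
      ‖fderiv ℝ (fun y => fderiv ℝ (F τ) y (EuclideanSpace.single j 1)) x‖ ≤ B := fun j τ x =>
    (norm_fderiv_fderiv_apply_le (hFs τ) (he j) x).trans
      ((hB₂ _ (hmem τ) x).trans ((le_max_right _ _).trans (le_max_right _ _)))
  have hr : Continuous fun τ => √(ν * (t - τ)) := by fun_prop
  have hut : u t = fun w => ∫ p, heatKernel d 1 p.2 * F p.1 (w - √(ν * (t - p.1)) • p.2)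
      ∂((volume.restrict (Ioo 0 t)).prod volume) := by
    funext w
    rw [hu, intervalIntegral.integral_of_le ht.1.le, integral_Ioc_eq_integral_Ioo,
      integral_prod _ (fderiv_fderiv_duhamel (he ⟨0, hd⟩) hFc hFs h0 h1 (h2 ⟨0, hd⟩) _ hr t w).1]
    refine setIntegral_congr_fun measurableSet_Ioo fun τ hτ => ?_
    have hFτ : F τ = f τ := by
      simp only [hF]
      rw [projIcc_of_mem hT.le ⟨hτ.1.le, hτ.2.le.trans ht.2⟩]
    simp only [hFτ]
    exact integral_heatKernel_mul_eq (mul_pos hν (sub_pos.mpr hτ.2)) _ _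
  unfold lap
  rw [hut, ← Finset.sum_sub_distrib]
  refine (mul_le_mul_of_nonneg_left (Finset.abs_sum_le_sum_abs _ _) hν.le).trans ?_
  rw [Finset.mul_sum]
  refine (Finset.sum_le_sum fun j _ => hbound j F B M ν hν hFc hFs h0 h1 (h2 j) hM
    (fun τ => hhol _ (hmem τ)) t x h hh).trans ?_
  rw [← Finset.sum_mul, ← Finset.sum_mul]
  gcongr
  linarith
end

section
/- Let C₀ ≥ 1. There exists a constant c > 0, depending only on C₀ and d, such that for every real p ≥ 2, every R > 0, and every real-valued scalar trigonometric polynomial f on ℝ^d whose frequency set S satisfies C₀^{−1} R ≤ |n| ≤ C₀ R for all n ∈ S: ∫_{[0,1]^d} (−Δf(x)) f(x) |f(x)|^{p−2} dx ≥ (c/p) R² ∫_{[0,1]^d} |f(x)|^p dx, where the integrand on the left is interpreted as 0 at points where f(x) = 0 (and for p = 2 the factor |f(x)|^{p−2} is taken to be 1). In particular c is independent of p, R and f. -/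
open MeasureTheory Set
open scoped ENNReal

def unitBox (d : ℕ) : Set (EuclideanSpace ℝ (Fin d)) :=
  {x | ∀ i, 0 ≤ x i ∧ x i ≤ 1}

/-- The standard lattice `ℤ^d` inside Euclidean space. -/
noncomputable abbrev intLattice (d : ℕ) : Submodule ℤ (EuclideanSpace ℝ (Fin d)) :=
  Submodule.span ℤ (range (EuclideanSpace.basisFun (Fin d) ℝ).toBasis)

/-- Invariance of a function under translations by `ℤ^d`. -/
def LatticePeriodic {d : ℕ} (u : EuclideanSpace ℝ (Fin d) → ℝ) : Prop :=
  ∀ v ∈ intLattice d, ∀ x, u (v + x) = u x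

lemma single_mem_intLattice {d : ℕ} (j : Fin d) :
    EuclideanSpace.single j (1 : ℝ) ∈ intLattice d :=
  Submodule.subset_span ⟨j, by simp⟩

lemma unitBox_eq_preimage (d : ℕ) :
    unitBox d = WithLp.ofLp ⁻¹' (Icc (0 : Fin d → ℝ) 1) := by
  ext x
  simp [unitBox, Pi.le_def, forall_and]

lemma isCompact_unitBox (d : ℕ) : IsCompact (unitBox d) := by
  rw [unitBox_eq_preimage]
  exact (PiLp.homeomorph 2 (fun _ : Fin d => ℝ)).isCompact_preimage.2 isCompact_Icc

lemma fundamentalDomain_ae_eq_unitBox (d : ℕ) :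
    ZSpan.fundamentalDomain (EuclideanSpace.basisFun (Fin d) ℝ).toBasis
      =ᵐ[volume] unitBox d := by
  have h : ZSpan.fundamentalDomain (EuclideanSpace.basisFun (Fin d) ℝ).toBasis =
      WithLp.ofLp ⁻¹' (Set.pi univ fun _ : Fin d => Ico (0 : ℝ) 1) := by
    ext x
    simp [ZSpan.mem_fundamentalDomain]
  rw [h, unitBox_eq_preimage]
  have key : (Set.pi univ fun _ : Fin d => Ico (0 : ℝ) 1) =ᵐ[volume] Icc (0 : Fin d → ℝ) 1 :=
    Measure.univ_pi_Ico_ae_eq_Icc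
  exact (PiLp.volume_preserving_ofLp (Fin d)).quasiMeasurePreserving.preimage_ae_eq key

lemma LatticePeriodic.setIntegral_add {d : ℕ} {u : EuclideanSpace ℝ (Fin d) → ℝ}
    (hu : LatticePeriodic u) (z : EuclideanSpace ℝ (Fin d)) :
    ∫ x in unitBox d, u (x + z) = ∫ x in unitBox d, u x := by
  rw [← setIntegral_congr_set (fundamentalDomain_ae_eq_unitBox d),
    ← setIntegral_congr_set (fundamentalDomain_ae_eq_unitBox d)]
  set b := (EuclideanSpace.basisFun (Fin d) ℝ).toBasis
  have hF := ZSpan.isAddFundamentalDomain b volume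
  have : VAddInvariantMeasure (intLattice d) (EuclideanSpace ℝ (Fin d)) volume :=
    inferInstanceAs <| VAddInvariantMeasure (intLattice d).toAddSubgroup _ volume
  have hF' : IsAddFundamentalDomain (intLattice d)
      ((fun x => z + x) '' ZSpan.fundamentalDomain b) volume := by
    refine hF.image_of_equiv (Equiv.addLeft z) ?_ (Equiv.refl _) ?_
    · exact (measurePreserving_add_left volume (-z)).quasiMeasurePreserving
    · intro g x
      simp [Submodule.vadd_def, add_left_comm]
  have h1 := (measurePreserving_add_left volume z).setIntegral_image_emb
    (measurableEmbedding_addLeft z) u (ZSpan.fundamentalDomain b)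
  simp_rw [add_comm _ z]
  rw [← h1]
  refine hF'.setIntegral_eq hF fun g x => ?_
  exact hu g g.2 x

lemma LatticePeriodic.setIntegral_fderiv_eq_zero {d : ℕ} {u : EuclideanSpace ℝ (Fin d) → ℝ}
    (hu : LatticePeriodic u) (hu' : ContDiff ℝ 1 u) (j : Fin d) :
    ∫ x in unitBox d, fderiv ℝ u x (EuclideanSpace.single j 1) = 0 := by
  set e : EuclideanSpace ℝ (Fin d) := EuclideanSpace.single j 1 with he
  have hc : Continuous fun x => fderiv ℝ u x e :=
    (hu'.continuous_fderiv one_ne_zero).clm_apply continuous_const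
  have hper : LatticePeriodic fun x => fderiv ℝ u x e := by
    intro v hv x
    have : (fun y => u (v + y)) = u := funext (hu v hv)
    have h2 := fderiv_comp_add_left (𝕜 := ℝ) (f := u) (x := x) v
    rw [this] at h2
    simp only [h2]
  have hline : ∀ x, ∫ t in (0 : ℝ)..1, fderiv ℝ u (x + t • e) e = 0 := by
    intro x
    have hd : ∀ t : ℝ, HasDerivAt (fun t : ℝ => u (x + t • e)) (fderiv ℝ u (x + t • e) e) t := by
      intro t
      have h1 : HasDerivAt (fun t : ℝ => x + t • e) e t := by
        simpa using ((hasDerivAt_id t).smul_const e).const_add x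
      exact (hu'.differentiable one_ne_zero _).hasFDerivAt.comp_hasDerivAt t h1
    rw [intervalIntegral.integral_eq_sub_of_hasDerivAt (fun t _ => hd t)
      (Continuous.intervalIntegrable (hc.comp (by fun_prop)) _ _)]
    simp [add_comm x e, hu e (single_mem_intLattice j) x]
  have hfub : ∫ x in unitBox d, ∫ t in (0 : ℝ)..1, fderiv ℝ u (x + t • e) e =
      ∫ t in (0 : ℝ)..1, ∫ x in unitBox d, fderiv ℝ u (x + t • e) e := by
    simp_rw [intervalIntegral.integral_of_le zero_le_one]
    refine integral_integral_swap ?_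
    rw [Measure.prod_restrict]
    have hK : IsCompact (unitBox d ×ˢ Icc (0 : ℝ) 1) := (isCompact_unitBox d).prod isCompact_Icc
    have hcont : Continuous fun q : EuclideanSpace ℝ (Fin d) × ℝ =>
        fderiv ℝ u (q.1 + q.2 • e) e := hc.comp (by fun_prop)
    exact (hcont.continuousOn.integrableOn_compact hK).mono_set
      (prod_mono_right Ioc_subset_Icc_self)
  simp_rw [hline, fun t : ℝ => hper.setIntegral_add (t • e)] at hfub
  simpa using hfub.symm

open scoped FourierTransform RealInnerProductSpace ContDiff in
/-- A smooth cutoff of `ξ ↦ ξ_j / |ξ|²` to an annulus is the sine transform of an integrable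
kernel whose cosine transform vanishes there. -/
lemma exists_integrable_sine_kernel (d : ℕ) (C₀ : ℝ) (hC₀ : 1 ≤ C₀) (j : Fin d) :
    ∃ κ : EuclideanSpace ℝ (Fin d) → ℝ, Integrable κ ∧
      ∀ ξ : EuclideanSpace ℝ (Fin d), C₀⁻¹ ≤ ‖ξ‖ → ‖ξ‖ ≤ C₀ →
        ∫ y, κ y * Real.cos (2 * Real.pi * ⟪ξ, y⟫) = 0 ∧
        ∫ y, κ y * Real.sin (2 * Real.pi * ⟪ξ, y⟫) = ξ j / ‖ξ‖ ^ 2 := by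
  have hC : 0 < C₀ := by linarith
  have hCi : 0 < C₀⁻¹ := inv_pos.2 hC
  let B₁ : ContDiffBump (0 : EuclideanSpace ℝ (Fin d)) := ⟨C₀, 2 * C₀, hC, by linarith⟩
  let B₂ : ContDiffBump (0 : EuclideanSpace ℝ (Fin d)) :=
    ⟨C₀⁻¹ / 4, C₀⁻¹ / 2, by positivity, by linarith⟩
  let m : EuclideanSpace ℝ (Fin d) → ℝ := fun ξ => (B₁ ξ - B₂ ξ) * (ξ j / ‖ξ‖ ^ 2)
  have hm : ContDiff ℝ ∞ m := by
    rw [contDiff_iff_contDiffAt]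
    intro ξ
    by_cases h0 : ξ = 0
    · refine (contDiffAt_const (c := (0 : ℝ))).congr_of_eventuallyEq ?_
      subst h0
      filter_upwards [B₁.eventuallyEq_one, B₂.eventuallyEq_one] with y h1 h2
      simp [m, h1, h2]
    · refine (B₁.contDiffAt.sub B₂.contDiffAt).mul (ContDiffAt.div ?_ ?_ ?_)
      · fun_prop
      · exact (contDiff_norm_sq ℝ).contDiffAt
      · simpa using h0
  have hsupp : HasCompactSupport fun ξ => (m ξ : ℂ) := by
    have : HasCompactSupport m := (B₁.hasCompactSupport.sub B₂.hasCompactSupport).mul_right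
    exact this.comp_left Complex.ofReal_zero
  have hm' : ContDiff ℝ ∞ fun ξ => (m ξ : ℂ) := Complex.ofRealCLM.contDiff.comp hm
  let φ := hsupp.toSchwartzMap hm'
  let ψ := 𝓕⁻ φ
  have hψ : Integrable (ψ : EuclideanSpace ℝ (Fin d) → ℂ) := ψ.integrable
  have hF : ∀ ξ : EuclideanSpace ℝ (Fin d), C₀⁻¹ ≤ ‖ξ‖ → ‖ξ‖ ≤ C₀ →
      𝓕 (ψ : EuclideanSpace ℝ (Fin d) → ℂ) ξ = ((ξ j / ‖ξ‖ ^ 2 : ℝ) : ℂ) := by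
    intro ξ h1 h2
    have h3 : 𝓕 ψ = φ := FourierTransform.fourier_fourierInv_eq φ
    rw [← SchwartzMap.fourier_coe, h3]
    have hb1 : B₁ ξ = 1 := B₁.one_of_mem_closedBall (by simpa [B₁] using h2)
    have hb2 : B₂ ξ = 0 := B₂.zero_of_le_dist (by simp only [dist_zero_right, B₂]; linarith)
    change ((m ξ : ℝ) : ℂ) = _
    simp [m, hb1, hb2]
  refine ⟨fun y => (ψ y).im, hψ.im, fun ξ h1 h2 => ?_⟩
  have ha := hF ξ h1 h2
  have hb := hF (-ξ) (by simpa using h1) (by simpa using h2)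
  have key : ∀ η : EuclideanSpace ℝ (Fin d), Integrable fun y =>
      Complex.exp ((↑(-2 * Real.pi * ⟪y, η⟫) : ℂ) * Complex.I) • ψ y := by
    intro η
    refine Integrable.bdd_smul (φ := fun y =>
      Complex.exp ((↑(-2 * Real.pi * ⟪y, η⟫) : ℂ) * Complex.I)) hψ 1 ?_
      (Filter.Eventually.of_forall fun y => ?_)
    · exact Continuous.aestronglyMeasurable (by fun_prop)
    · rw [Complex.norm_exp_ofReal_mul_I]
  rw [Real.fourier_eq'] at ha hb
  have hsum := congrArg Complex.im (congrArg₂ (· + ·) ha hb)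
  have hdif := congrArg Complex.re (congrArg₂ (· - ·) ha hb)
  simp only at hsum hdif
  have hadd : Integrable fun y => Complex.exp ((↑(-2 * Real.pi * ⟪y, ξ⟫) : ℂ) * Complex.I) • ψ y +
      Complex.exp ((↑(-2 * Real.pi * ⟪y, -ξ⟫) : ℂ) * Complex.I) • ψ y := (key ξ).add (key (-ξ))
  have hsub : Integrable fun y => Complex.exp ((↑(-2 * Real.pi * ⟪y, ξ⟫) : ℂ) * Complex.I) • ψ y -
      Complex.exp ((↑(-2 * Real.pi * ⟪y, -ξ⟫) : ℂ) * Complex.I) • ψ y := (key ξ).sub (key (-ξ))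
  rw [← integral_add (key ξ) (key (-ξ)), ← RCLike.im_eq_complex_im, ← integral_im hadd] at hsum
  rw [← integral_sub (key ξ) (key (-ξ)), ← RCLike.re_eq_complex_re, ← integral_re hsub] at hdif
  constructor
  · have h : ∀ y, RCLike.im (Complex.exp ((↑(-2 * Real.pi * ⟪y, ξ⟫) : ℂ) * Complex.I) • ψ y +
        Complex.exp ((↑(-2 * Real.pi * ⟪y, -ξ⟫) : ℂ) * Complex.I) • ψ y) =
        2 * ((ψ y).im * Real.cos (2 * Real.pi * ⟪ξ, y⟫)) := by
      intro y
      rw [inner_neg_right, real_inner_comm ξ y, mul_neg, neg_mul, neg_mul, neg_neg]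
      simp only [RCLike.im_eq_complex_im, smul_eq_mul, Complex.add_im, Complex.mul_im,
        Complex.exp_ofReal_mul_I_re, Complex.exp_ofReal_mul_I_im, Real.cos_neg, Real.sin_neg]
      ring
    simp only [h] at hsum
    rw [integral_const_mul] at hsum
    simpa only [RCLike.im_eq_complex_im, Complex.add_im, Complex.ofReal_im, add_zero, mul_eq_zero, OfNat.ofNat_ne_zero,
      false_or] using hsum
  · have h : ∀ y, RCLike.re (Complex.exp ((↑(-2 * Real.pi * ⟪y, ξ⟫) : ℂ) * Complex.I) • ψ y -
        Complex.exp ((↑(-2 * Real.pi * ⟪y, -ξ⟫) : ℂ) * Complex.I) • ψ y) =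
        2 * ((ψ y).im * Real.sin (2 * Real.pi * ⟪ξ, y⟫)) := by
      intro y
      rw [inner_neg_right, real_inner_comm ξ y, mul_neg, neg_mul, neg_mul, neg_neg]
      simp only [RCLike.re_eq_complex_re, smul_eq_mul, Complex.sub_re, Complex.mul_re,
        Complex.exp_ofReal_mul_I_re, Complex.exp_ofReal_mul_I_im, Real.cos_neg, Real.sin_neg]
      ring
    simp only [h] at hdif
    rw [integral_const_mul] at hdif
    simp only [RCLike.re_eq_complex_re, Complex.sub_re, Complex.ofReal_re, PiLp.neg_apply, norm_neg, neg_div] at hdif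
    linarith

lemma hasDerivAt_abs_rpow_mul_self {p : ℝ} (hp : 2 ≤ p) (t : ℝ) :
    HasDerivAt (fun t : ℝ => |t| ^ (p - 2) * t) ((p - 1) * |t| ^ (p - 2)) t := by
  have hc : Continuous fun t : ℝ => |t| ^ (p - 2) :=
    continuous_abs.rpow_const fun _ => Or.inr (by linarith)
  have hne : ∀ y : ℝ, y ≠ 0 →
      HasDerivAt (fun t : ℝ => |t| ^ (p - 2) * t) ((p - 1) * |y| ^ (p - 2)) y := by
    intro y hy
    have h := ((hasDerivAt_abs hy).rpow_const (p := p - 2) (Or.inl (abs_ne_zero.2 hy))).mul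
      (hasDerivAt_id y)
    refine h.congr_deriv ?_
    have h1 : |y| ^ (p - 2) = |y| ^ (p - 2 - 1) * |y| := by
      rw [← Real.rpow_add_one (abs_ne_zero.2 hy)]
      ring_nf
    have h2 : (SignType.sign y : ℝ) * y = |y| := by rw [sign_mul_self]
    simp only [id, mul_one]
    linear_combination (p - 2) * |y| ^ (p - 2 - 1) * h2 - (p - 2) * h1
  by_cases ht : t = 0
  · subst ht
    exact hasDerivAt_of_hasDerivAt_of_ne (g := fun t => (p - 1) * |t| ^ (p - 2)) hne
      (hc.mul continuous_id).continuousAt (hc.const_mul _).continuousAt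
  · exact hne t ht

lemma LatticePeriodic.setIntegral_fderiv_mul {d : ℕ} {p : ℝ} (hp : 2 ≤ p)
    {f g : EuclideanSpace ℝ (Fin d) → ℝ} (hf : LatticePeriodic f) (hg : LatticePeriodic g)
    (hf' : ContDiff ℝ 1 f) (hg' : ContDiff ℝ 1 g) (j : Fin d) :
    ∫ x in unitBox d, fderiv ℝ g x (EuclideanSpace.single j 1) * (|f x| ^ (p - 2) * f x) =
      -((p - 1) * ∫ x in unitBox d,
        g x * (|f x| ^ (p - 2) * fderiv ℝ f x (EuclideanSpace.single j 1))) := by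
  set e : EuclideanSpace ℝ (Fin d) := EuclideanSpace.single j 1
  have hc : Continuous fun t : ℝ => |t| ^ (p - 2) :=
    continuous_abs.rpow_const fun _ => Or.inr (by linarith)
  have hφ : ContDiff ℝ 1 fun t : ℝ => |t| ^ (p - 2) * t := by
    rw [contDiff_one_iff_deriv]
    refine ⟨fun t => (hasDerivAt_abs_rpow_mul_self hp t).differentiableAt, ?_⟩
    rw [funext fun t => (hasDerivAt_abs_rpow_mul_self hp t).deriv]
    exact hc.const_mul _
  have hw : ContDiff ℝ 1 fun x => |f x| ^ (p - 2) * f x := hφ.comp hf'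
  have hu : LatticePeriodic fun x => g x * (|f x| ^ (p - 2) * f x) := fun v hv x => by
    simp only [hf v hv x, hg v hv x]
  have hzero := hu.setIntegral_fderiv_eq_zero (hg'.mul hw) j
  have hderiv : ∀ x, fderiv ℝ (fun x => g x * (|f x| ^ (p - 2) * f x)) x e =
      fderiv ℝ g x e * (|f x| ^ (p - 2) * f x) +
        (p - 1) * (g x * (|f x| ^ (p - 2) * fderiv ℝ f x e)) := by
    intro x
    have h1 := (hasDerivAt_abs_rpow_mul_self hp (f x)).comp_hasFDerivAt x
      (hf'.differentiable one_ne_zero x).hasFDerivAt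
    have h2 := (hg'.differentiable one_ne_zero x).hasFDerivAt.mul h1
    rw [show (fun x => g x * (|f x| ^ (p - 2) * f x)) =
      g * ((fun t : ℝ => |t| ^ (p - 2) * t) ∘ f) from rfl, h2.fderiv]
    simp
    ring
  have hcf : Continuous fun x => fderiv ℝ f x e :=
    (hf'.continuous_fderiv one_ne_zero).clm_apply continuous_const
  have hcg : Continuous fun x => fderiv ℝ g x e :=
    (hg'.continuous_fderiv one_ne_zero).clm_apply continuous_const
  have hi1 : IntegrableOn (fun x => fderiv ℝ g x e * (|f x| ^ (p - 2) * f x)) (unitBox d) :=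
    (hcg.mul hw.continuous).continuousOn.integrableOn_compact (isCompact_unitBox d)
  have hi2 : IntegrableOn (fun x => (p - 1) * (g x * (|f x| ^ (p - 2) * fderiv ℝ f x e)))
      (unitBox d) :=
    (continuous_const.mul (hg'.continuous.mul ((hc.comp hf'.continuous).mul
      hcf))).continuousOn.integrableOn_compact (isCompact_unitBox d)
  change ∫ x in unitBox d, fderiv ℝ _ x e = 0 at hzero
  simp_rw [hderiv] at hzero
  rw [integral_add hi1 hi2, integral_const_mul] at hzero
  linarith

lemma abs_rpow_mul_mul_le {p l : ℝ} (hp : 2 ≤ p) (hl : 0 < l) (s t h : ℝ) :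
    |t * (|s| ^ (p - 2) * h)| ≤ l / 2 * (|s| ^ (p - 2) * h ^ 2) +
      1 / (2 * l) * ((p - 2) / p * |s| ^ p + 2 / p * |t| ^ p) := by
  have hp0 : 0 < p := by linarith
  have hs : 0 ≤ |s| ^ (p - 2) := by positivity
  have young : |s| ^ (p - 2) * t ^ 2 ≤ (p - 2) / p * |s| ^ p + 2 / p * |t| ^ p := by
    have h1 := Real.geom_mean_le_arith_mean2_weighted (w₁ := (p - 2) / p) (w₂ := 2 / p)
      (p₁ := |s| ^ p) (p₂ := |t| ^ p) (div_nonneg (by linarith) hp0.le) (by positivity)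
      (by positivity) (by positivity) (by field_simp; ring)
    rw [← Real.rpow_mul (abs_nonneg _), ← Real.rpow_mul (abs_nonneg _),
      mul_div_cancel₀ _ hp0.ne', mul_div_cancel₀ _ hp0.ne', Real.rpow_two, sq_abs] at h1
    exact h1
  have amgm : |t| * |h| ≤ l / 2 * h ^ 2 + 1 / (2 * l) * t ^ 2 := by
    have h2 : l / 2 * h ^ 2 + 1 / (2 * l) * t ^ 2 - |t| * |h| = (l * |h| - |t|) ^ 2 / (2 * l) := by
      rw [← sq_abs h, ← sq_abs t]
      field_simp
      ring
    have : 0 ≤ (l * |h| - |t|) ^ 2 / (2 * l) := by positivity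
    linarith
  calc |t * (|s| ^ (p - 2) * h)| = |s| ^ (p - 2) * (|t| * |h|) := by
        rw [abs_mul, abs_mul, abs_of_nonneg hs]; ring
    _ ≤ |s| ^ (p - 2) * (l / 2 * h ^ 2 + 1 / (2 * l) * t ^ 2) := by gcongr
    _ = l / 2 * (|s| ^ (p - 2) * h ^ 2) + 1 / (2 * l) * (|s| ^ (p - 2) * t ^ 2) := by ring
    _ ≤ _ := by gcongr

lemma LatticePeriodic.abs_setIntegral_translate_mul_le {d : ℕ} {p l : ℝ} (hp : 2 ≤ p)
    (hl : 0 < l) {f h : EuclideanSpace ℝ (Fin d) → ℝ} (hf : LatticePeriodic f)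
    (hfc : Continuous f) (hhc : Continuous h) (z : EuclideanSpace ℝ (Fin d)) :
    |∫ x in unitBox d, f (x + z) * (|f x| ^ (p - 2) * h x)| ≤
      l / 2 * (∫ x in unitBox d, |f x| ^ (p - 2) * h x ^ 2) +
        1 / (2 * l) * ∫ x in unitBox d, |f x| ^ p := by
  have hp0 : 0 < p := by linarith
  have hc : Continuous fun t : ℝ => |t| ^ (p - 2) :=
    continuous_abs.rpow_const fun _ => Or.inr (by linarith)
  have hc' : Continuous fun t : ℝ => |t| ^ p :=
    continuous_abs.rpow_const fun _ => Or.inr (by linarith)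
  have hint : ∀ u : EuclideanSpace ℝ (Fin d) → ℝ, Continuous u → IntegrableOn u (unitBox d) :=
    fun u hu => hu.continuousOn.integrableOn_compact (isCompact_unitBox d)
  have c1 : Continuous fun x => |f x| ^ (p - 2) * h x ^ 2 := (hc.comp hfc).mul (hhc.pow 2)
  have c2 : Continuous fun x => |f x| ^ p := hc'.comp hfc
  have c3 : Continuous fun x => |f (x + z)| ^ p := c2.comp (by fun_prop)
  have hper : LatticePeriodic fun x => |f x| ^ p := fun v hv x => by simp only [hf v hv x]
  have i1 := (hint _ c1).const_mul (l / 2)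
  have i2 := (hint _ c2).const_mul ((p - 2) / p)
  have i3 := (hint _ c3).const_mul (2 / p)
  have i4 : Integrable (fun x => 1 / (2 * l) * ((p - 2) / p * |f x| ^ p + 2 / p * |f (x + z)| ^ p))
      (volume.restrict (unitBox d)) := (i2.add i3).const_mul _
  have i5 : Integrable (fun x => l / 2 * (|f x| ^ (p - 2) * h x ^ 2) +
      1 / (2 * l) * ((p - 2) / p * |f x| ^ p + 2 / p * |f (x + z)| ^ p))
      (volume.restrict (unitBox d)) := i1.add i4
  calc |∫ x in unitBox d, f (x + z) * (|f x| ^ (p - 2) * h x)|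
      ≤ ∫ x in unitBox d, (l / 2 * (|f x| ^ (p - 2) * h x ^ 2) +
          1 / (2 * l) * ((p - 2) / p * |f x| ^ p + 2 / p * |f (x + z)| ^ p)) :=
        norm_integral_le_of_norm_le (f := fun x => f (x + z) * (|f x| ^ (p - 2) * h x)) i5
          (Filter.Eventually.of_forall fun x => abs_rpow_mul_mul_le hp hl _ _ _)
    _ = _ := by
        rw [integral_add i1 i4, integral_const_mul, integral_const_mul,
          integral_add i2 i3, integral_const_mul, integral_const_mul, hper.setIntegral_add z]
        field_simp
        ring

lemma LatticePeriodic.abs_setIntegral_average_mul_le {d : ℕ} {p l : ℝ} (hp : 2 ≤ p)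
    (hl : 0 < l) {f h : EuclideanSpace ℝ (Fin d) → ℝ} (hf : LatticePeriodic f)
    (hfc : Continuous f) (hhc : Continuous h) {B : ℝ} (hB : ∀ x, |f x| ≤ B)
    {κ : EuclideanSpace ℝ (Fin d) → ℝ} (hκ : Integrable κ) (r : ℝ) :
    |∫ x in unitBox d, (∫ y, κ y * f (x + r • y)) * (|f x| ^ (p - 2) * h x)| ≤
      (∫ y, |κ y|) * (l / 2 * (∫ x in unitBox d, |f x| ^ (p - 2) * h x ^ 2) +
        1 / (2 * l) * ∫ x in unitBox d, |f x| ^ p) := by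
  set Q := l / 2 * (∫ x in unitBox d, |f x| ^ (p - 2) * h x ^ 2) +
        1 / (2 * l) * ∫ x in unitBox d, |f x| ^ p with hQ
  have hc : Continuous fun t : ℝ => |t| ^ (p - 2) :=
    continuous_abs.rpow_const fun _ => Or.inr (by linarith)
  set w := fun x => |f x| ^ (p - 2) * h x with hw
  have hwc : Continuous w := (hc.comp hfc).mul hhc
  have hwi : IntegrableOn w (unitBox d) :=
    hwc.continuousOn.integrableOn_compact (isCompact_unitBox d)
  have hprod : Integrable (Function.uncurry fun x y => f (x + r • y) * (w x * κ y))
      ((volume.restrict (unitBox d)).prod volume) := by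
    refine (Integrable.mul_prod hwi hκ).bdd_mul (c := B) ?_
      (Filter.Eventually.of_forall fun q => hB _)
    exact Continuous.aestronglyMeasurable (by fun_prop)
  have hswap : ∫ x in unitBox d, (∫ y, κ y * f (x + r • y)) * w x =
      ∫ y, κ y * ∫ x in unitBox d, f (x + r • y) * w x := by
    calc _ = ∫ x in unitBox d, ∫ y, f (x + r • y) * (w x * κ y) := by
          congr 1 with x
          rw [← integral_mul_const]
          congr 1 with y
          ring
      _ = ∫ y, ∫ x in unitBox d, f (x + r • y) * (w x * κ y) := integral_integral_swap hprod
      _ = _ := by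
          congr 1 with y
          rw [← integral_const_mul]
          congr 1 with x
          ring
  rw [hswap, ← integral_mul_const Q fun y => |κ y|, ← Real.norm_eq_abs]
  refine norm_integral_le_of_norm_le (hκ.abs.mul_const Q) (Filter.Eventually.of_forall fun y => ?_)
  rw [norm_mul, Real.norm_eq_abs, Real.norm_eq_abs]
  gcongr
  exact hf.abs_setIntegral_translate_mul_le hp hl hfc hhc _

/-- Energy dissipation for a periodic function that is the divergence of averages of itself
at scale `R⁻¹`. -/
lemma LatticePeriodic.energy_dissipation {d : ℕ} (hd : 1 ≤ d) {p R M : ℝ} (hp : 2 ≤ p)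
    (hR : 0 < R) (hM : 0 < M) {f : EuclideanSpace ℝ (Fin d) → ℝ}
    {g κ : Fin d → EuclideanSpace ℝ (Fin d) → ℝ} (hf : LatticePeriodic f)
    (hf' : ContDiff ℝ 2 f) {B : ℝ} (hB : ∀ x, |f x| ≤ B)
    (hg : ∀ j, LatticePeriodic (g j)) (hg' : ∀ j, ContDiff ℝ 1 (g j))
    (hκ : ∀ j, Integrable (κ j)) (hκM : ∀ j, ∫ y, |κ j y| ≤ M)
    (hdiv : ∀ x, ∑ j, fderiv ℝ (g j) x (EuclideanSpace.single j 1) = f x)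
    (hgκ : ∀ j x, g j x = -(2 * Real.pi * R)⁻¹ * ∫ y, κ j y * f (x + R⁻¹ • y)) :
    (4 * Real.pi ^ 2 / (M ^ 2 * d) / p) * R ^ 2 * ∫ x in unitBox d, |f x| ^ p ≤
      ∫ x in unitBox d, -(lap d f x) * f x * |f x| ^ (p - 2) := by
  have hp0 : 0 < p := by linarith
  have hd0 : (0 : ℝ) < d := by exact_mod_cast hd
  have hc : Continuous fun t : ℝ => |t| ^ (p - 2) :=
    continuous_abs.rpow_const fun _ => Or.inr (by linarith)
  have hf1 : ContDiff ℝ 1 f := hf'.of_le one_le_two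
  have hw : Continuous fun x => |f x| ^ (p - 2) * f x :=
    (hc.comp hf'.continuous).mul hf'.continuous
  let D : Fin d → EuclideanSpace ℝ (Fin d) → ℝ := fun j x =>
    fderiv ℝ f x (EuclideanSpace.single j 1)
  have hD : ∀ j, ContDiff ℝ 1 (D j) := fun j =>
    (hf'.fderiv_right (m := 1) le_rfl).clm_apply contDiff_const
  have hDper : ∀ j, LatticePeriodic (D j) := by
    intro j v hv x
    have h1 : (fun y => f (v + y)) = f := funext (hf v hv)
    have h2 := fderiv_comp_add_left (𝕜 := ℝ) (f := f) (x := x) v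
    rw [h1] at h2
    simp only [D, h2]
  have hint : ∀ u : Fin d → EuclideanSpace ℝ (Fin d) → ℝ, (∀ j, ContDiff ℝ 1 (u j)) →
      ∀ j ∈ Finset.univ, IntegrableOn (fun x => fderiv ℝ (u j) x (EuclideanSpace.single j 1) *
        (|f x| ^ (p - 2) * f x)) (unitBox d) := fun u hu j _ =>
    ((((hu j).continuous_fderiv one_ne_zero).clm_apply continuous_const).mul
      hw).continuousOn.integrableOn_compact (isCompact_unitBox d)
  set N := ∫ x in unitBox d, |f x| ^ p with hN
  have hN0 : 0 ≤ N := integral_nonneg fun x => by positivity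
  set E : Fin d → ℝ := fun j => ∫ x in unitBox d, |f x| ^ (p - 2) * D j x ^ 2 with hE
  have hE0 : ∀ j, 0 ≤ E j := fun j => integral_nonneg fun x => by positivity
  have hlap : ∫ x in unitBox d, -(lap d f x) * f x * |f x| ^ (p - 2) = (p - 1) * ∑ j, E j := by
    calc _ = ∫ x in unitBox d, -∑ j, fderiv ℝ (D j) x (EuclideanSpace.single j 1) *
          (|f x| ^ (p - 2) * f x) := by
          congr 1 with x
          rw [← Finset.sum_mul]
          simp only [lap, D]
          ring
      _ = ∑ j, (p - 1) * E j := by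
          rw [integral_neg, integral_finsetSum _ (hint D hD), ← Finset.sum_neg_distrib]
          refine Finset.sum_congr rfl fun j _ => ?_
          rw [hf.setIntegral_fderiv_mul hp (hDper j) hf1 (hD j), neg_neg]
          refine congrArg ((p - 1) * ·) (integral_congr_ae (Filter.Eventually.of_forall fun x => ?_))
          simp only [D]
          ring
      _ = _ := by rw [Finset.mul_sum]
  set A := (p - 1) * (2 * Real.pi * R)⁻¹ * M with hA
  have hA0 : 0 < A := by
    have : 0 < p - 1 := by linarith
    positivity
  set l := A * d with hl
  have hl0 : 0 < l := by positivity
  have hNE : N ≤ A * (l / 2 * ∑ j, E j + d * (1 / (2 * l) * N)) := by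
    calc N = ∫ x in unitBox d, ∑ j, fderiv ℝ (g j) x (EuclideanSpace.single j 1) *
          (|f x| ^ (p - 2) * f x) := by
          refine integral_congr_ae (Filter.Eventually.of_forall fun x => ?_)
          dsimp only
          rw [← Finset.sum_mul, hdiv x]
          by_cases h0 : f x = 0
          · simp [h0, hp0.ne']
          · have h1 : |f x| ^ p = |f x| ^ (p - 2) * |f x| ^ (2 : ℝ) := by
              rw [← Real.rpow_add (abs_pos.2 h0)]
              ring_nf
            rw [h1, Real.rpow_two, sq_abs]
            ring
      _ = ∑ j, (p - 1) * (2 * Real.pi * R)⁻¹ * ∫ x in unitBox d,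
            (∫ y, κ j y * f (x + R⁻¹ • y)) * (|f x| ^ (p - 2) * D j x) := by
          rw [integral_finsetSum _ (hint g hg')]
          refine Finset.sum_congr rfl fun j _ => ?_
          have h1 : ∫ x in unitBox d, g j x * (|f x| ^ (p - 2) * D j x) =
              -(2 * Real.pi * R)⁻¹ * ∫ x in unitBox d,
                (∫ y, κ j y * f (x + R⁻¹ • y)) * (|f x| ^ (p - 2) * D j x) := by
            rw [← integral_const_mul]
            congr 1 with x
            rw [hgκ j x]
            ring
          rw [hf.setIntegral_fderiv_mul hp (hg j) hf1 (hg' j), h1]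
          ring
      _ ≤ ∑ j, (p - 1) * (2 * Real.pi * R)⁻¹ * (M * (l / 2 * E j + 1 / (2 * l) * N)) := by
          refine Finset.sum_le_sum fun j _ => ?_
          have h1 : 0 ≤ p - 1 := by linarith
          refine mul_le_mul_of_nonneg_left ?_ (by positivity)
          refine (le_abs_self _).trans ((hf.abs_setIntegral_average_mul_le hp hl0
            hf'.continuous (hD j).continuous hB (hκ j) R⁻¹).trans ?_)
          have := hE0 j
          exact mul_le_mul_of_nonneg_right (hκM j) (by positivity)
      _ = _ := by
          rw [← Finset.mul_sum, ← Finset.mul_sum, Finset.sum_add_distrib, ← Finset.mul_sum,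
            Finset.sum_const, Finset.card_univ, Fintype.card_fin, nsmul_eq_mul]
          ring
  have hNE' : N ≤ A ^ 2 * d * ∑ j, E j := by
    have h1 : A * (l / 2 * ∑ j, E j + d * (1 / (2 * l) * N)) =
        A ^ 2 * d * (∑ j, E j) / 2 + N / 2 := by
      rw [hl]
      field_simp
    linarith
  rw [hlap]
  have hp1 : 0 < p - 1 := by linarith
  calc (4 * Real.pi ^ 2 / (M ^ 2 * d) / p) * R ^ 2 * N
      ≤ (4 * Real.pi ^ 2 / (M ^ 2 * d) / (p - 1)) * R ^ 2 * N := by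
        gcongr
        linarith
    _ ≤ (4 * Real.pi ^ 2 / (M ^ 2 * d) / (p - 1)) * R ^ 2 * (A ^ 2 * d * ∑ j, E j) := by gcongr
    _ = (p - 1) * ∑ j, E j := by
        rw [hA]
        field_simp
        ring

section TrigMode

open scoped RealInnerProductSpace ContDiff

/-- The real trigonometric mode `a cos(2π⟨v,x⟩) + b sin(2π⟨v,x⟩)`. -/
noncomputable def trigMode {d : ℕ} (v : EuclideanSpace ℝ (Fin d)) (a b : ℝ)
    (x : EuclideanSpace ℝ (Fin d)) : ℝ :=
  a * Real.cos (2 * Real.pi * ⟪v, x⟫) + b * Real.sin (2 * Real.pi * ⟪v, x⟫)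

variable {d : ℕ} (v : EuclideanSpace ℝ (Fin d)) (a b : ℝ)

lemma contDiff_trigMode {n : WithTop ℕ∞} : ContDiff ℝ n (trigMode v a b) := by
  have h : ContDiff ℝ n fun x => 2 * Real.pi * ⟪v, x⟫ :=
    contDiff_const.mul (innerSL ℝ v).contDiff
  exact (contDiff_const.mul h.cos).add (contDiff_const.mul h.sin)

lemma fderiv_trigMode_single (x : EuclideanSpace ℝ (Fin d)) (j : Fin d) :
    fderiv ℝ (trigMode v a b) x (EuclideanSpace.single j 1) =
      2 * Real.pi * v j * trigMode v b (-a) x := by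
  have h1 : HasFDerivAt (fun x => 2 * Real.pi * ⟪v, x⟫) ((2 * Real.pi) • innerSL ℝ v) x :=
    (innerSL ℝ v).hasFDerivAt.const_mul _
  have h2 : HasFDerivAt (trigMode v a b) _ x := (h1.cos.const_mul a).add (h1.sin.const_mul b)
  rw [h2.fderiv]
  simp [trigMode, EuclideanSpace.inner_single_right]
  ring

lemma abs_trigMode_le (x : EuclideanSpace ℝ (Fin d)) : |trigMode v a b x| ≤ |a| + |b| := by
  refine (abs_add_le _ _).trans (add_le_add ?_ ?_)
  · rw [abs_mul]
    exact mul_le_of_le_one_right (abs_nonneg _) (Real.abs_cos_le_one _)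
  · rw [abs_mul]
    exact mul_le_of_le_one_right (abs_nonneg _) (Real.abs_sin_le_one _)

lemma latticePeriodic_trigMode (n : Fin d → ℤ) :
    LatticePeriodic (trigMode (WithLp.toLp 2 fun i => (n i : ℝ)) a b) := by
  intro z hz x
  obtain ⟨k, hk⟩ : ∃ k : ℤ, ⟪(WithLp.toLp 2 fun i => (n i : ℝ) : EuclideanSpace ℝ (Fin d)), z⟫
      = k := by
    have h1 := (Module.Basis.mem_span_iff_repr_mem ℤ _ _).1 hz
    choose m hm using h1
    refine ⟨∑ i, n i * m i, ?_⟩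
    simp only [OrthonormalBasis.coe_toBasis_repr_apply, EuclideanSpace.basisFun_repr,
      algebraMap_int_eq, eq_intCast] at hm
    simp [PiLp.inner_apply, ← hm, mul_comm]
  have h : 2 * Real.pi * ⟪(WithLp.toLp 2 fun i => (n i : ℝ) : EuclideanSpace ℝ (Fin d)), z + x⟫ =
      2 * Real.pi * ⟪(WithLp.toLp 2 fun i => (n i : ℝ) : EuclideanSpace ℝ (Fin d)), x⟫ +
        k * (2 * Real.pi) := by
    rw [inner_add_right, hk]
    ring
  simp only [trigMode, h, Real.cos_add_int_mul_two_pi, Real.sin_add_int_mul_two_pi]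

lemma integrable_mul_trigMode {κ : EuclideanSpace ℝ (Fin d) → ℝ} (hκ : Integrable κ)
    (x : EuclideanSpace ℝ (Fin d)) (r : ℝ) :
    Integrable fun y => κ y * trigMode v a b (x + r • y) := by
  refine hκ.mul_bdd (c := |a| + |b|) ?_
    (Filter.Eventually.of_forall fun y => abs_trigMode_le v a b _)
  have := (contDiff_trigMode v a b (n := 0)).continuous
  exact Continuous.aestronglyMeasurable (by fun_prop)

lemma integral_mul_trigMode {κ : EuclideanSpace ℝ (Fin d) → ℝ} (hκ : Integrable κ) {r m : ℝ}
    (hcos : ∫ y, κ y * Real.cos (2 * Real.pi * ⟪r • v, y⟫) = 0)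
    (hsin : ∫ y, κ y * Real.sin (2 * Real.pi * ⟪r • v, y⟫) = m)
    (x : EuclideanSpace ℝ (Fin d)) :
    ∫ y, κ y * trigMode v a b (x + r • y) = m * trigMode v b (-a) x := by
  have i1 : Integrable fun y => κ y * Real.cos (2 * Real.pi * ⟪r • v, y⟫) := by
    simpa [trigMode] using integrable_mul_trigMode (r • v) 1 0 hκ 0 1
  have i2 : Integrable fun y => κ y * Real.sin (2 * Real.pi * ⟪r • v, y⟫) := by
    simpa [trigMode] using integrable_mul_trigMode (r • v) 0 1 hκ 0 1
  have h : ∀ y, κ y * trigMode v a b (x + r • y) =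
      trigMode v a b x * (κ y * Real.cos (2 * Real.pi * ⟪r • v, y⟫)) +
        trigMode v b (-a) x * (κ y * Real.sin (2 * Real.pi * ⟪r • v, y⟫)) := by
    intro y
    simp only [trigMode, inner_add_right, inner_smul_right, real_inner_smul_left, mul_add,
      Real.cos_add, Real.sin_add]
    ring
  simp_rw [h]
  rw [integral_add (i1.const_mul _) (i2.const_mul _), integral_const_mul, integral_const_mul,
    hcos, hsin]
  ring

end TrigMode

lemma LatticePeriodic.finsetSum {d : ℕ} {ι : Type*} (S : Finset ι)
    {u : ι → EuclideanSpace ℝ (Fin d) → ℝ} (hu : ∀ n ∈ S, LatticePeriodic (u n)) :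
    LatticePeriodic fun x => ∑ n ∈ S, u n x := fun v hv x =>
  Finset.sum_congr rfl fun n hn => hu n hn v hv x

/-- `L^p`-energy dissipation with constant `c/p` for trigonometric
polynomials with frequencies in an annulus of fixed thickness `C₀`. -/
theorem stmt16 (d : ℕ) (hd : 1 ≤ d) (C₀ : ℝ) (hC₀ : 1 ≤ C₀) :
    ∃ c : ℝ, 0 < c ∧
      ∀ p : ℝ, 2 ≤ p →
      ∀ R : ℝ, 0 < R →
      ∀ (S : Finset (Fin d → ℤ)) (a b : (Fin d → ℤ) → ℝ) (f : (EuclideanSpace ℝ (Fin d)) → ℝ),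
        (∀ n ∈ S, C₀⁻¹ * R ≤ Real.sqrt (∑ i, ((n i : ℝ)) ^ 2) ∧
          Real.sqrt (∑ i, ((n i : ℝ)) ^ 2) ≤ C₀ * R) →
        (∀ x, f x = ∑ n ∈ S,
          (a n * Real.cos (2 * Real.pi * ∑ i, (n i : ℝ) * x i) +
            b n * Real.sin (2 * Real.pi * ∑ i, (n i : ℝ) * x i))) →
        (c / p) * R ^ 2 * ∫ x in unitBox d, |f x| ^ p ≤
          ∫ x in unitBox d, -(lap d f x) * f x * |f x| ^ (p - 2) := by
  choose κ hκ hκξ using exists_integrable_sine_kernel d C₀ hC₀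
  set M := 1 + ∑ j, ∫ y, |κ j y| with hM
  have hκ0 : ∀ j, 0 ≤ ∫ y, |κ j y| := fun j => integral_nonneg fun y => abs_nonneg _
  have hM0 : 0 < M := by
    have := Finset.sum_nonneg fun j (_ : j ∈ Finset.univ) => hκ0 j
    linarith
  have hκM : ∀ j, ∫ y, |κ j y| ≤ M := fun j => by
    have := Finset.single_le_sum (fun j _ => hκ0 j) (Finset.mem_univ j)
    linarith
  have hd0 : (0 : ℝ) < d := by exact_mod_cast hd
  refine ⟨4 * Real.pi ^ 2 / (M ^ 2 * d), by positivity, ?_⟩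
  intro p hp R hR S a b f hS hf
  let v : (Fin d → ℤ) → EuclideanSpace ℝ (Fin d) := fun n => WithLp.toLp 2 fun i => (n i : ℝ)
  have hv : ∀ n, ‖v n‖ = Real.sqrt (∑ i, ((n i : ℝ)) ^ 2) := fun n => by
    simp [EuclideanSpace.norm_eq, v]
  have hfv : f = fun x => ∑ n ∈ S, trigMode (v n) (a n) (b n) x := by
    ext x
    rw [hf x]
    refine Finset.sum_congr rfl fun n _ => ?_
    simp [trigMode, v, PiLp.inner_apply, mul_comm]
  have hCi : 0 < C₀⁻¹ := inv_pos.2 (by linarith)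
  have hv0 : ∀ n ∈ S, 0 < ‖v n‖ := fun n hn =>
    (mul_pos hCi hR).trans_le (by rw [hv]; exact (hS n hn).1)
  let q : Fin d → (Fin d → ℤ) → ℝ := fun j n => v n j / (2 * Real.pi * ‖v n‖ ^ 2)
  let g : Fin d → EuclideanSpace ℝ (Fin d) → ℝ := fun j x =>
    ∑ n ∈ S, trigMode (v n) (-(q j n * b n)) (q j n * a n) x
  refine LatticePeriodic.energy_dissipation hd hp hR hM0 (f := f) (g := g) (κ := κ)
    (B := ∑ n ∈ S, (|a n| + |b n|)) ?_ ?_ ?_ ?_ ?_ hκ hκM ?_ ?_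
  · rw [hfv]
    exact LatticePeriodic.finsetSum S fun n _ => latticePeriodic_trigMode _ _ n
  · rw [hfv]
    exact ContDiff.sum fun n _ => contDiff_trigMode _ _ _
  · intro x
    rw [hfv]
    exact (Finset.abs_sum_le_sum_abs _ _).trans
      (Finset.sum_le_sum fun n _ => abs_trigMode_le _ _ _ _)
  · exact fun j => LatticePeriodic.finsetSum S fun n _ => latticePeriodic_trigMode _ _ n
  · exact fun j => ContDiff.sum fun n _ => contDiff_trigMode _ _ _
  · intro x
    have hderiv : ∀ j, fderiv ℝ (g j) x (EuclideanSpace.single j 1) =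
        ∑ n ∈ S, v n j ^ 2 / ‖v n‖ ^ 2 * trigMode (v n) (a n) (b n) x := by
      intro j
      rw [fderiv_fun_sum fun n _ =>
        (contDiff_trigMode (n := 1) _ _ _).differentiable one_ne_zero x]
      rw [sum_apply]
      refine Finset.sum_congr rfl fun n hn => ?_
      have := hv0 n hn
      rw [fderiv_trigMode_single]
      simp only [trigMode, q]
      field_simp
    simp_rw [hderiv]
    rw [Finset.sum_comm, hfv]
    refine Finset.sum_congr rfl fun n hn => ?_
    have h0 := hv0 n hn
    rw [← Finset.sum_mul, ← Finset.sum_div, ← EuclideanSpace.real_norm_sq_eq,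
      div_self (by positivity), one_mul]
  · intro j x
    have hint : ∀ n ∈ S, ∫ y, κ j y * trigMode (v n) (a n) (b n) (x + R⁻¹ • y) =
        R * v n j / ‖v n‖ ^ 2 * trigMode (v n) (b n) (-a n) x := by
      intro n hn
      have h0 := hv0 n hn
      have hnorm : ‖R⁻¹ • v n‖ = R⁻¹ * ‖v n‖ := by
        rw [norm_smul, Real.norm_of_nonneg (inv_pos.2 hR).le]
      obtain ⟨hcos, hsin⟩ := hκξ j (R⁻¹ • v n)
        (by rw [hnorm, hv, inv_mul_eq_div, le_div_iff₀ hR]; exact (hS n hn).1)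
        (by rw [hnorm, hv, inv_mul_eq_div, div_le_iff₀ hR]; exact (hS n hn).2)
      rw [integral_mul_trigMode _ _ _ (hκ j) hcos hsin, hnorm]
      congr 1
      simp only [PiLp.smul_apply, smul_eq_mul]
      field_simp
    simp_rw [hfv, Finset.mul_sum]
    rw [integral_finsetSum _ fun n _ => integrable_mul_trigMode _ _ _ (hκ j) _ _,
      Finset.sum_congr rfl hint, Finset.mul_sum]
    refine Finset.sum_congr rfl fun n hn => ?_
    have h0 := hv0 n hn
    simp only [trigMode, q]
    field_simp
    ring
end
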